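/- Let β ∈ (0,1], a ≥ 0 and b ∈ (0,1). Then there exist real numbers c₊ < 0 and c* ≥ a(1−b) such that, denoting by 'a solution with parameter c' a three times continuously differentiable f : [0,∞) → ℝ satisfying f''' + f·f'' + β·f'·(f'−1) = 0 on [0,∞) with f(0) = a, f'(0) = b, f''(0) = c: (i) for every c < c₊ there is no solution with parameter c on all of [0,∞); (ii) there is a solution with parameter c₊ that satisfies f'' < 0 on [0,∞) and f'(t) → 0 as t → +∞; (iii) for every c ∈ (c₊, 0) there is a solution with parameter c and a point t₀ > 0 with f'' < 0 on (0, t₀), f'' > 0 on (t₀, ∞), and f'(t) → 1 as t → +∞; (iv) for every c ∈ [0, c*] there is a solution with parameter c satisfying f'' ≥ 0 and b ≤ f' ≤ 1 on [0,∞) and f'(t) → 1 as t → +∞; (v) for every c > c* there is a solution with parameter c and a point t₀ > 0 with f'' > 0 on [0, t₀), f'' < 0 on (t₀, ∞), and f'(t) → 1 as t → +∞. -/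

import Mathlib

open Set Filter Topology

/-- `f` is a solution of `f''' + f f'' + β f'(f'-1) = 0` on `[0,∞)` with the
initial data `f(0) = a`, `f'(0) = b`, `f''(0) = c` (shooting parameter `c`). -/
def IsSolWithParam (β a b c : ℝ) (f : ℝ → ℝ) : Prop :=
  ContDiff ℝ 3 f ∧
  (∀ t ∈ Set.Ici (0 : ℝ), deriv (deriv (deriv f)) t + f t * deriv (deriv f) t
    + β * deriv f t * (deriv f t - 1) = 0) ∧
  f 0 = a ∧ deriv f 0 = b ∧ deriv (deriv f) 0 = c

namespace FS

/-- first-order vector field -/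
noncomputable def F (β : ℝ) (x : ℝ × ℝ × ℝ) : ℝ × ℝ × ℝ :=
  (x.2.1, x.2.2, -(x.1 * x.2.2) + β * x.2.1 * (1 - x.2.1))

/-- solution of the system on `[0,T]` -/
def Sol (β : ℝ) (p q r : ℝ → ℝ) (T : ℝ) : Prop :=
  ∀ t ∈ Icc (0 : ℝ) T, HasDerivAt p (q t) t ∧ HasDerivAt q (r t) t ∧
    HasDerivAt r (-(p t * r t) + β * q t * (1 - q t)) t

/-- initial data -/
def Ini (a b c : ℝ) (p q r : ℝ → ℝ) : Prop := p 0 = a ∧ q 0 = b ∧ r 0 = c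

lemma Sol.mono {β : ℝ} {p q r : ℝ → ℝ} {T T' : ℝ} (h : Sol β p q r T) (hT : T' ≤ T) :
    Sol β p q r T' := fun t ht => h t ⟨ht.1, ht.2.trans hT⟩

lemma F_lip (β R : ℝ) : ∃ K, LipschitzOnWith K (F β) (Metric.closedBall 0 R) := by
  have h : ContDiff ℝ 1 (F β) := by unfold F; fun_prop
  exact (h.locallyLipschitz.locallyLipschitzOn).exists_lipschitzOnWith_of_compact
    (isCompact_closedBall _ _)

lemma mem_cube {x : ℝ × ℝ × ℝ} {R : ℝ} :
    x ∈ Metric.closedBall (0 : ℝ × ℝ × ℝ) R ↔ |x.1| ≤ R ∧ |x.2.1| ≤ R ∧ |x.2.2| ≤ R := by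
  simp [Prod.norm_def]

lemma Sol.vec {β : ℝ} {p q r : ℝ → ℝ} {T : ℝ} (h : Sol β p q r T) :
    ∀ t ∈ Icc 0 T, HasDerivAt (fun t => (p t, q t, r t)) (F β (p t, q t, r t)) t :=
  fun t ht => (h t ht).1.prodMk ((h t ht).2.1.prodMk (h t ht).2.2)

lemma Sol.cont {β : ℝ} {p q r : ℝ → ℝ} {T : ℝ} (h : Sol β p q r T) :
    ContinuousOn p (Icc 0 T) ∧ ContinuousOn q (Icc 0 T) ∧ ContinuousOn r (Icc 0 T) :=
  ⟨fun t ht => (h t ht).1.continuousAt.continuousWithinAt,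
   fun t ht => (h t ht).2.1.continuousAt.continuousWithinAt,
   fun t ht => (h t ht).2.2.continuousAt.continuousWithinAt⟩

/-- Gronwall: constant depending only on the bound `C`. -/
lemma gron (β C T : ℝ) : ∃ K : ℝ, 0 < K ∧ ∀ p q r p' q' r' : ℝ → ℝ, ∀ S, S ≤ T →
    Sol β p q r S → Sol β p' q' r' S →
    (∀ t ∈ Icc 0 S, |p t| ≤ C ∧ |q t| ≤ C ∧ |r t| ≤ C) →
    (∀ t ∈ Icc 0 S, |p' t| ≤ C ∧ |q' t| ≤ C ∧ |r' t| ≤ C) →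
    p 0 = p' 0 → q 0 = q' 0 →
    ∀ t ∈ Icc 0 S, |q t - q' t| ≤ K * |r 0 - r' 0| ∧ |r t - r' t| ≤ K * |r 0 - r' 0| := by
  obtain ⟨K, hK⟩ := F_lip β C
  refine ⟨Real.exp (K * T), Real.exp_pos _, ?_⟩
  intro p q r p' q' r' S hS h h' hb hb' h0 h1 t ht
  have := dist_le_of_trajectories_ODE_of_mem (v := fun _ => F β) (K := K)
    (s := fun _ => Metric.closedBall 0 C) (f := fun t => (p t, q t, r t))
    (g := fun t => (p' t, q' t, r' t)) (a := 0) (b := S) (δ := |r 0 - r' 0|)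
    (fun _ _ => hK)
    (fun t ht => (h.vec t ht).continuousAt.continuousWithinAt)
    (fun t ht => (h.vec t ⟨ht.1, ht.2.le⟩).hasDerivWithinAt)
    (fun t ht => mem_cube.2 (hb t ⟨ht.1, ht.2.le⟩))
    (fun t ht => (h'.vec t ht).continuousAt.continuousWithinAt)
    (fun t ht => (h'.vec t ⟨ht.1, ht.2.le⟩).hasDerivWithinAt)
    (fun t ht => mem_cube.2 (hb' t ⟨ht.1, ht.2.le⟩))
    (by simp [Prod.dist_eq, h0, h1, Real.dist_eq]) t ht
  have hE : |r 0 - r' 0| * Real.exp (K * (t - 0)) ≤ Real.exp (K * T) * |r 0 - r' 0| := by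
    rw [mul_comm]
    gcongr
    linarith [ht.2]
  have h2 := this.trans hE
  rw [Prod.dist_eq, Prod.dist_eq, max_le_iff, max_le_iff] at h2
  exact ⟨by simpa [Real.dist_eq] using h2.2.1, by simpa [Real.dist_eq] using h2.2.2⟩

lemma Sol.bdd {β : ℝ} {p q r : ℝ → ℝ} {T : ℝ} (h : Sol β p q r T) :
    ∃ C, ∀ t ∈ Icc 0 T, |p t| ≤ C ∧ |q t| ≤ C ∧ |r t| ≤ C := by
  obtain ⟨C1, h1⟩ := isCompact_Icc.exists_bound_of_continuousOn h.cont.1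
  obtain ⟨C2, h2⟩ := isCompact_Icc.exists_bound_of_continuousOn h.cont.2.1
  obtain ⟨C3, h3⟩ := isCompact_Icc.exists_bound_of_continuousOn h.cont.2.2
  refine ⟨max C1 (max C2 C3), fun t ht => ⟨?_, ?_, ?_⟩⟩
  · exact (h1 t ht).trans (le_max_left _ _)
  · exact (h2 t ht).trans ((le_max_left _ _).trans (le_max_right _ _))
  · exact (h3 t ht).trans ((le_max_right _ _).trans (le_max_right _ _))

lemma uniq {β : ℝ} {p q r p' q' r' : ℝ → ℝ} {T : ℝ} (h : Sol β p q r T) (h' : Sol β p' q' r' T)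
    (h0 : p 0 = p' 0) (h1 : q 0 = q' 0) (h2 : r 0 = r' 0) :
    ∀ t ∈ Icc 0 T, p t = p' t ∧ q t = q' t ∧ r t = r' t := by
  obtain ⟨C, hC⟩ := h.bdd
  obtain ⟨C', hC'⟩ := h'.bdd
  obtain ⟨K, hK⟩ := F_lip β (max C C')
  have := ODE_solution_unique_of_mem_Icc_right (v := fun _ => F β) (K := K)
    (s := fun _ => Metric.closedBall 0 (max C C')) (f := fun t => (p t, q t, r t))
    (g := fun t => (p' t, q' t, r' t)) (a := 0) (b := T)
    (fun _ _ => hK)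
    (fun t ht => (h.vec t ht).continuousAt.continuousWithinAt)
    (fun t ht => (h.vec t ⟨ht.1, ht.2.le⟩).hasDerivWithinAt)
    (fun t ht => Metric.closedBall_subset_closedBall (le_max_left _ _) (mem_cube.2 (hC t ⟨ht.1, ht.2.le⟩)))
    (fun t ht => (h'.vec t ht).continuousAt.continuousWithinAt)
    (fun t ht => (h'.vec t ⟨ht.1, ht.2.le⟩).hasDerivWithinAt)
    (fun t ht => Metric.closedBall_subset_closedBall (le_max_right _ _) (mem_cube.2 (hC' t ⟨ht.1, ht.2.le⟩)))
    (by simp [h0, h1, h2])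
  intro t ht
  simpa using this ht

/-- backward uniqueness against the two families of affine solutions -/
lemma uniq_left {β : ℝ} {p q r : ℝ → ℝ} {T m : ℝ} (hT : 0 ≤ T) (h : Sol β p q r T)
    (hm : β * m * (1 - m) = 0) (h1 : q T = m) (h2 : r T = 0) : q 0 = m := by
  have h' : Sol β (fun t => p T + m * (t - T)) (fun _ => m) (fun _ => 0) T := by
    intro t ht
    refine ⟨?_, hasDerivAt_const _ _, ?_⟩
    · simpa using (((hasDerivAt_id t).sub_const T).const_mul m).const_add (p T)
    · rw [hm]; simpa using hasDerivAt_const t (0:ℝ)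
  obtain ⟨C, hC⟩ := h.bdd
  obtain ⟨C', hC'⟩ := h'.bdd
  obtain ⟨K, hK⟩ := F_lip β (max C C')
  have := ODE_solution_unique_of_mem_Icc_left (v := fun _ => F β) (K := K)
    (s := fun _ => Metric.closedBall 0 (max C C')) (f := fun t => (p t, q t, r t))
    (g := fun t => (p T + m * (t - T), m, 0)) (a := 0) (b := T)
    (fun _ _ => hK)
    (fun t ht => (h.vec t ht).continuousAt.continuousWithinAt)
    (fun t ht => (h.vec t ⟨ht.1.le, ht.2⟩).hasDerivWithinAt)
    (fun t ht => Metric.closedBall_subset_closedBall (le_max_left _ _) (mem_cube.2 (hC t ⟨ht.1.le, ht.2⟩)))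
    (fun t ht => (h'.vec t ht).continuousAt.continuousWithinAt)
    (fun t ht => (h'.vec t ⟨ht.1.le, ht.2⟩).hasDerivWithinAt)
    (fun t ht => Metric.closedBall_subset_closedBall (le_max_right _ _) (mem_cube.2 (hC' t ⟨ht.1.le, ht.2⟩)))
    (by simp [h1, h2])
  have := this (show (0:ℝ) ∈ Icc 0 T from ⟨le_rfl, hT⟩)
  simp at this
  exact this.2.1

/-- clamp -/
noncomputable def cl (R : ℝ) (x : ℝ) : ℝ := max (min x R) (-R)

lemma cl_eq {R x : ℝ} (h : |x| ≤ R) : cl R x = x := by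
  have := abs_le.1 h
  unfold cl; rw [min_eq_left this.2, max_eq_left this.1]

lemma cl_abs {R x : ℝ} (hR : 0 ≤ R) : |cl R x| ≤ R := by
  unfold cl; rw [abs_le]
  exact ⟨le_max_right _ _, max_le (min_le_right _ _) (by linarith)⟩

lemma cl_lip (R : ℝ) : LipschitzWith 1 (cl R) :=
  (LipschitzWith.id.min_const R).max_const (-R)

/-- vector clamp -/
noncomputable def cl3 (R : ℝ) (x : ℝ × ℝ × ℝ) : ℝ × ℝ × ℝ := (cl R x.1, cl R x.2.1, cl R x.2.2)

lemma cl3_lip (R : ℝ) : LipschitzWith 1 (cl3 R) := by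
  have h1 := (cl_lip R).comp (LipschitzWith.prod_fst (α := ℝ) (β := ℝ × ℝ))
  have h2 := (cl_lip R).comp ((LipschitzWith.prod_fst (α := ℝ) (β := ℝ)).comp
    (LipschitzWith.prod_snd (α := ℝ) (β := ℝ × ℝ)))
  have h3 := (cl_lip R).comp ((LipschitzWith.prod_snd (α := ℝ) (β := ℝ)).comp
    (LipschitzWith.prod_snd (α := ℝ) (β := ℝ × ℝ)))
  have h := h1.prodMk (h2.prodMk h3)
  simp only [Function.comp_def, mul_one, max_self] at h
  exact h

lemma cl3_mem {R : ℝ} (hR : 0 ≤ R) (x) : cl3 R x ∈ Metric.closedBall (0 : ℝ × ℝ × ℝ) R :=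
  mem_cube.2 ⟨cl_abs hR, cl_abs hR, cl_abs hR⟩

lemma trunc_exists (β R N : ℝ) (hR : 0 ≤ R) (hN : 0 ≤ N) (x₀ : ℝ × ℝ × ℝ) :
    ∃ X : ℝ → ℝ × ℝ × ℝ, X 0 = x₀ ∧ ∀ t ∈ Ioo (-N) N, HasDerivAt X (F β (cl3 R (X t))) t := by
  obtain ⟨K, hK⟩ := F_lip β R
  obtain ⟨L, hL⟩ := (isCompact_closedBall (0 : ℝ × ℝ × ℝ) R).exists_bound_of_continuousOn
    hK.continuousOn
  have hL0 : 0 ≤ L := (norm_nonneg _).trans (hL 0 (Metric.mem_closedBall_self hR))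
  have hlip : LipschitzWith (K * 1) (fun x => F β (cl3 R x)) := by
    rw [← lipschitzOnWith_univ]
    exact hK.comp (cl3_lip R).lipschitzOnWith (fun x _ => cl3_mem hR x)
  have hP : IsPicardLindelof (fun _ => fun x => F β (cl3 R x)) (tmin := -N) (tmax := N)
      ⟨0, by constructor <;> linarith⟩ x₀ ⟨L * N, by positivity⟩ 0 ⟨L, hL0⟩ (K * 1) := by
    apply IsPicardLindelof.of_time_independent
    · intro x _
      exact hL _ (cl3_mem hR x)
    · exact hlip.lipschitzOnWith
    · simp only [sub_zero, zero_sub, neg_neg, max_self, NNReal.coe_zero]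
      exact le_rfl
  obtain ⟨X, h0, hX⟩ := hP.exists_eq_forall_mem_Icc_hasDerivWithinAt₀
  exact ⟨X, h0, fun t ht => (hX t ⟨ht.1.le, ht.2.le⟩).hasDerivAt (Icc_mem_nhds ht.1 ht.2)⟩

end FS

namespace FS

lemma grow {u u' : ℝ → ℝ} {s T k : ℝ} (hu : ∀ t ∈ Icc s T, HasDerivAt u (u' t) t)
    (hk : ∀ t ∈ Icc s T, k ≤ u' t) : ∀ x ∈ Icc s T, ∀ y ∈ Icc s T, x ≤ y →
    u x + k * (y - x) ≤ u y := by
  intro x hx y hy hxy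
  have := (convex_Icc s T).mul_sub_le_image_sub_of_le_deriv (f := u) (C := k)
    (fun t ht => (hu t ht).continuousAt.continuousWithinAt)
    (fun t ht => (hu t (interior_subset ht)).differentiableAt.differentiableWithinAt)
    (fun t ht => by rw [(hu t (interior_subset ht)).deriv]; exact hk t (interior_subset ht))
    x hx y hy hxy
  linarith

lemma growU {u u' : ℝ → ℝ} {s T k : ℝ} (hu : ∀ t ∈ Icc s T, HasDerivAt u (u' t) t)
    (hk : ∀ t ∈ Icc s T, u' t ≤ k) : ∀ x ∈ Icc s T, ∀ y ∈ Icc s T, x ≤ y →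
    u y ≤ u x + k * (y - x) := by
  intro x hx y hy hxy
  have := grow (u := fun t => - u t) (u' := fun t => - u' t) (k := -k)
    (fun t ht => (hu t ht).neg) (fun t ht => by linarith [hk t ht]) x hx y hy hxy
  linarith

lemma left_deriv {u : ℝ → ℝ} {d s t : ℝ} (hd : HasDerivAt u d t) (hst : s < t)
    (h : ∀ x ∈ Ioo s t, u t ≤ u x) : d ≤ 0 := by
  have h1 : Tendsto (slope u t) (𝓝[<] t) (𝓝 d) :=
    (hasDerivAt_iff_tendsto_slope.1 hd).mono_left (nhdsWithin_mono _ (fun x hx => ne_of_lt hx))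
  refine le_of_tendsto h1 ?_
  filter_upwards [Ioo_mem_nhdsLT hst] with x hx
  rw [slope_def_field]
  exact div_nonpos_of_nonneg_of_nonpos (by linarith [h x hx]) (by linarith [hx.2])

lemma right_deriv {u : ℝ → ℝ} {d s t : ℝ} (hd : HasDerivAt u d t) (hst : t < s)
    (h : ∀ x ∈ Ioo t s, u x ≤ u t) : d ≤ 0 := by
  have h1 : Tendsto (slope u t) (𝓝[>] t) (𝓝 d) :=
    (hasDerivAt_iff_tendsto_slope.1 hd).mono_left (nhdsWithin_mono _ (fun x hx => ne_of_gt hx))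
  refine le_of_tendsto h1 ?_
  filter_upwards [Ioo_mem_nhdsGT hst] with x hx
  rw [slope_def_field]
  exact div_nonpos_of_nonpos_of_nonneg (by linarith [h x hx]) (by linarith [hx.1])

lemma first_zero {u : ℝ → ℝ} {s T : ℝ} (hu : ContinuousOn u (Icc s T)) (hsT : s ≤ T)
    (h0 : 0 < u s) (h1 : u T ≤ 0) :
    ∃ t ∈ Ioc s T, u t = 0 ∧ ∀ x ∈ Ico s t, 0 < u x := by
  set Z := Icc s T ∩ u ⁻¹' (Iic 0) with hZ
  have hZc : IsClosed Z := hu.preimage_isClosed_of_isClosed isClosed_Icc isClosed_Iic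
  have hne : Z.Nonempty := ⟨T, ⟨hsT, le_rfl⟩, h1⟩
  have hbd : BddBelow Z := ⟨s, fun x hx => hx.1.1⟩
  have hm := hZc.csInf_mem hne hbd
  set t := sInf Z with ht
  have hpos : ∀ x ∈ Ico s t, 0 < u x := by
    intro x hx
    by_contra hc
    have : x ∈ Z := ⟨⟨hx.1, hx.2.le.trans hm.1.2⟩, not_lt.1 hc⟩
    exact absurd (csInf_le hbd this) (not_le.2 hx.2)
  have hst : s < t := by
    rcases eq_or_lt_of_le hm.1.1 with h | h
    · have := hm.2; rw [← h] at this; exact absurd h0 (not_lt.2 this)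
    · exact h
  refine ⟨t, ⟨hst, hm.1.2⟩, le_antisymm hm.2 ?_, hpos⟩
  have hc : ContinuousWithinAt u (Ico s t) t :=
    (hu t hm.1).mono (fun x hx => ⟨hx.1, hx.2.le.trans hm.1.2⟩)
  have hcl : t ∈ closure (Ico s t) := by rw [closure_Ico hst.ne]; exact ⟨hst.le, le_rfl⟩
  have := mem_closure_iff_nhdsWithin_neBot.1 hcl
  refine ge_of_tendsto hc ?_
  filter_upwards [self_mem_nhdsWithin] with x hx using (hpos x hx).le

lemma pos_of {u u' : ℝ → ℝ} {s T : ℝ} (hu : ∀ t ∈ Icc s T, HasDerivAt u (u' t) t)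
    (h0 : 0 ≤ u s)
    (h : ∀ t ∈ Icc s T, (∀ x ∈ Icc s t, 0 ≤ u x) → u t = 0 → 0 < u' t) :
    ∀ t ∈ Ioc s T, 0 < u t := by
  intro t ht
  by_contra hc
  push Not at hc
  have hsT : s ≤ T := ht.1.le.trans ht.2
  -- right end of the initial nonnegative stretch
  have hcont : ContinuousOn u (Icc s T) := fun x hx => (hu x hx).continuousAt.continuousWithinAt
  -- find x0 with u > 0 on (s, x0]
  have key : ∃ x0 ∈ Ico s t, 0 < u x0 ∧ ∀ x ∈ Icc s x0, 0 ≤ u x := by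
    rcases h0.eq_or_lt with h00 | h00
    · have hd := h s ⟨le_rfl, hsT⟩ (fun x hx => by
        have : x = s := le_antisymm hx.2 hx.1
        rw [this]; exact h0) h00.symm
      have hev : ∀ᶠ x in 𝓝[>] s, 0 < u x := by
        have h1 : Tendsto (slope u s) (𝓝[>] s) (𝓝 (u' s)) :=
          (hasDerivAt_iff_tendsto_slope.1 (hu s ⟨le_rfl, hsT⟩)).mono_left
            (nhdsWithin_mono _ (fun x hx => ne_of_gt hx))
        filter_upwards [h1.eventually (lt_mem_nhds hd), self_mem_nhdsWithin] with x hx hx2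
        rw [slope_def_field, ← h00, sub_zero] at hx
        have hx2' : 0 < x - s := by simpa using hx2
        exact (div_pos_iff_of_pos_right hx2').1 hx
      obtain ⟨y, hy, hy2⟩ := (mem_nhdsGT_iff_exists_Ioo_subset).1 hev
      have hy' : s < y := hy
      have hmin : s < min y t := lt_min hy ht.1
      refine ⟨(s + min y t) / 2, ⟨by linarith, by linarith [min_le_right y t]⟩, hy2 ⟨by linarith, by linarith [min_le_left y t]⟩, ?_⟩
      intro x hx
      rcases hx.1.eq_or_lt with h | h
      · rw [← h]; exact h0
      · exact (hy2 ⟨h, by linarith [min_le_left y t, hx.2]⟩ : 0 < u x).le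
    · refine ⟨s, ⟨le_rfl, ht.1⟩, h00, fun x hx => ?_⟩
      have : x = s := le_antisymm hx.2 hx.1
      rw [this]; exact h0
  obtain ⟨x0, hx0, hx0p, hx0n⟩ := key
  obtain ⟨z, hz, hz0, hzp⟩ := first_zero (u := u) (s := x0) (T := t)
    (hcont.mono (Icc_subset_Icc hx0.1 ht.2)) hx0.2.le hx0p hc
  have hd := h z ⟨hx0.1.trans hz.1.le, hz.2.trans ht.2⟩ (fun x hx => by
    rcases le_or_gt x x0 with h' | h'
    · exact hx0n x ⟨hx.1, h'⟩
    · rcases hx.2.eq_or_lt with h'' | h''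
      · rw [h'', hz0]
      · exact (hzp x ⟨h'.le, h''⟩).le) hz0
  have := left_deriv (hu z ⟨hx0.1.trans hz.1.le, hz.2.trans ht.2⟩) hz.1
    (fun x hx => by rw [hz0]; exact (hzp x ⟨hx.1.le, hx.2⟩).le)
  linarith

/-- a priori bounds -/
noncomputable def BM (b c N : ℝ) : ℝ := b + (|c| + N) * N
noncomputable def BD (a b c N : ℝ) : ℝ := 
  |c| + N + BM b c N + (a + BM b c N * N) * (1 + BM b c N)

lemma apriori {β a b c N T : ℝ} (hβ1 : 0 < β) (hβ2 : β ≤ 1) (ha : 0 ≤ a) (hb1 : 0 < b) (hb2 : b < 1)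
    (hN : 0 ≤ N) {p q r : ℝ → ℝ} (hS : Sol β p q r T) (hI : Ini a b c p q r) (hTN : T ≤ N)
    (hq : ∀ t ∈ Icc 0 T, 0 ≤ q t) :
    ∀ t ∈ Icc 0 T, a ≤ p t ∧ |p t| ≤ BD a b c N ∧ |q t| ≤ BD a b c N ∧ |r t| ≤ BD a b c N := by
  obtain ⟨hp0, hq0, hr0⟩ := hI
  have hp : ∀ t ∈ Icc 0 T, a ≤ p t := by
    intro t ht
    have := grow (fun t ht => (hS t ht).1) hq 0 ⟨le_rfl, ht.1.trans ht.2⟩ t ht ht.1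
    rw [hp0] at this; linarith
  have hrU : ∀ t ∈ Icc 0 T, r t ≤ |c| + N := by
    have h1 : ∀ t ∈ Ioc 0 T, 0 < (|c| + t) - r t := by
      refine pos_of (u := fun t => (|c| + t) - r t)
        (u' := fun t => 1 - (-(p t * r t) + β * q t * (1 - q t)))
        (fun t ht => ((hasDerivAt_id t).const_add _).sub (hS t ht).2.2) ?_ ?_
      · simp [hr0, le_abs_self]
      · intro t ht _ h0
        have hr : 0 ≤ r t := by
          have := abs_nonneg c
          have := ht.1
          linarith
        have := mul_nonneg (ha.trans (hp t ht)) hr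
        have h4 : q t * (1 - q t) ≤ 1/4 := by nlinarith [sq_nonneg (q t - 1/2)]
        have : β * (q t * (1 - q t)) ≤ β * (1/4) := by gcongr
        nlinarith
    intro t ht
    rcases ht.1.eq_or_lt with h | h
    · rw [← h, hr0]; linarith [le_abs_self c]
    · linarith [h1 t ⟨h, ht.2⟩, ht.2]
  have hcN : 0 ≤ |c| + N := by positivity
  have hqU : ∀ t ∈ Icc 0 T, q t ≤ BM b c N := by
    intro t ht
    have := growU (fun t ht => (hS t ht).2.1) hrU 0 ⟨le_rfl, ht.1.trans ht.2⟩ t ht ht.1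
    rw [hq0] at this
    have h2 : (|c| + N) * (t - 0) ≤ (|c| + N) * N := by
      gcongr; linarith [ht.2]
    unfold BM; linarith
  have hM : 0 ≤ BM b c N := by unfold BM; positivity
  have hpU : ∀ t ∈ Icc 0 T, p t ≤ a + BM b c N * N := by
    intro t ht
    have := growU (fun t ht => (hS t ht).1) hqU 0 ⟨le_rfl, ht.1.trans ht.2⟩ t ht ht.1
    rw [hp0] at this
    have h2 : (BM b c N) * (t - 0) ≤ (BM b c N) * N := by
      gcongr; linarith [ht.2]
    linarith
  have hrL : ∀ t ∈ Icc 0 T, -|c| - (a + BM b c N * N) * BM b c N ≤ r t := by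
    intro t ht
    have := grow (u := fun t => r t + p t * q t) (k := 0)
      (fun t ht => (hS t ht).2.2.add ((hS t ht).1.mul (hS t ht).2.1))
      (fun t ht => by
        have := hq t ht
        have : (0:ℝ) ≤ (1 - β) * (q t * q t) := by
          apply mul_nonneg <;> nlinarith
        nlinarith [mul_nonneg hβ1.le (hq t ht)]) 0 ⟨le_rfl, ht.1.trans ht.2⟩ t ht ht.1
    simp only [hr0, hp0, hq0] at this
    have h3 : p t * q t ≤ (a + BM b c N * N) * BM b c N := by
      have := hqU t ht
      have := hpU t ht
      have := hq t ht
      have := hp t ht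
      gcongr
    have h4 : 0 ≤ a * b := by positivity
    linarith [neg_abs_le c]
  intro t ht
  have e1 := hp t ht
  have e2 := hpU t ht
  have e3 := hq t ht
  have e4 := hqU t ht
  have e5 := hrL t ht
  have e6 := hrU t ht
  have h1 : 0 ≤ |c| := abs_nonneg c
  have h2 : 0 ≤ a + BM b c N * N := by positivity
  have h3 : 0 ≤ (a + BM b c N * N) * BM b c N := by positivity
  have h4 : BD a b c N = |c| + N + BM b c N + (a + BM b c N * N) + (a + BM b c N * N) * BM b c N := by
    unfold BD; ring
  refine ⟨e1, ?_, ?_, ?_⟩ <;> rw [abs_le, h4] <;> constructor <;> linarith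

end FS

namespace FS

lemma comp_deriv {X : ℝ → ℝ × ℝ × ℝ} {x' : ℝ × ℝ × ℝ} {t : ℝ} (h : HasDerivAt X x' t) :
    HasDerivAt (fun t => (X t).1) x'.1 t ∧ HasDerivAt (fun t => (X t).2.1) x'.2.1 t ∧
    HasDerivAt (fun t => (X t).2.2) x'.2.2 t :=
  ⟨h.fst, h.snd.fst, h.snd.snd⟩

lemma step {β a b : ℝ} (hβ1 : 0 < β) (hβ2 : β ≤ 1) (ha : 0 ≤ a)
    (hb1 : 0 < b) (hb2 : b < 1) (c : ℝ) {N : ℝ} (hN : 0 < N) :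
    (∃ T > 0, ∃ p q r, Sol β p q r T ∧ Ini a b c p q r ∧ q T < 0) ∨
    (∃ p q r, Sol β p q r N ∧ Ini a b c p q r ∧ ∀ t ∈ Icc 0 N, 0 < q t) := by
  set R := |BD a b c N| + a + b + |c| + 1 with hR
  have hR0 : 0 ≤ R := by positivity
  have hBR : BD a b c N < R := by
    have := le_abs_self (BD a b c N); have := abs_nonneg c
    linarith
  obtain ⟨X, hX0, hX⟩ := trunc_exists β R (N + 1) hR0 (by linarith) (a, b, c)
  set p := fun t => (X t).1 with hp
  set q := fun t => (X t).2.1 with hq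
  set r := fun t => (X t).2.2 with hr
  have hI : Ini a b c p q r := by simp [Ini, hp, hq, hr, hX0]
  have hd : ∀ t ∈ Icc 0 (N+1), t < N + 1 → |p t| ≤ R → |q t| ≤ R → |r t| ≤ R →
      HasDerivAt p (q t) t ∧ HasDerivAt q (r t) t ∧
        HasDerivAt r (-(p t * r t) + β * q t * (1 - q t)) t := by
    intro t ht ht' h1 h2 h3
    have e : cl3 R (X t) = X t := by
      unfold cl3
      rw [cl_eq h1, cl_eq h2, cl_eq h3]
    have := hX t ⟨by linarith [ht.1], ht'⟩
    rw [e] at this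
    exact comp_deriv this
  have hcX : ∀ t ∈ Icc 0 N, ContinuousAt X t := fun t ht =>
    (hX t ⟨by linarith [ht.1], by linarith [ht.2]⟩).continuousAt
  have hcp : ∀ t ∈ Icc 0 N, ContinuousAt p t := fun t ht => (hcX t ht).fst
  have hcq : ∀ t ∈ Icc 0 N, ContinuousAt q t := fun t ht => (hcX t ht).snd.fst
  have hcr : ∀ t ∈ Icc 0 N, ContinuousAt r t := fun t ht => (hcX t ht).snd.snd
  set u : ℝ → ℝ := fun t => min (q t) (min (R - |p t|) (min (R - |q t|) (R - |r t|))) with hu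
  have hcu : ContinuousOn u (Icc 0 N) := by
    intro t ht
    have h1 := hcp t ht
    have h2 := hcq t ht
    have h3 := hcr t ht
    have : ContinuousAt u t := by
      simp only [hu]
      fun_prop
    exact this.continuousWithinAt
  have hu0 : 0 < u 0 := by
    have h1 := abs_nonneg (BD a b c N)
    have h2 := abs_nonneg c
    simp only [hu, hI.1, hI.2.1, hI.2.2, lt_min_iff, abs_of_nonneg ha, abs_of_pos hb1]
    refine ⟨hb1, ?_, ?_, ?_⟩ <;> linarith
  by_cases hall : ∀ t ∈ Icc 0 N, 0 < u t
  · right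
    refine ⟨p, q, r, fun t ht => ?_, hI, fun t ht => ?_⟩
    · have := hall t ht
      simp only [hu, lt_min_iff] at this
      exact hd t ⟨ht.1, by linarith [ht.2]⟩ (by linarith [ht.2]) (by linarith) (by linarith) (by linarith)
    · have := hall t ht
      simp only [hu, lt_min_iff] at this
      exact this.1
  · left
    push Not at hall
    obtain ⟨t1, ht1, hut1⟩ := hall
    obtain ⟨T, hT, hT0, hTp⟩ := first_zero (hcu.mono (Icc_subset_Icc le_rfl ht1.2)) ht1.1 hu0 hut1
    have hTN : T ≤ N := hT.2.trans ht1.2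
    have hun : ∀ t ∈ Icc 0 T, 0 ≤ u t := by
      intro t ht
      rcases ht.2.eq_or_lt with h | h
      · rw [h, hT0]
      · exact (hTp t ⟨ht.1, h⟩).le
    have hS : Sol β p q r T := by
      intro t ht
      have := hun t ht
      simp only [hu, le_min_iff] at this
      exact hd t ⟨ht.1, by linarith [ht.2]⟩ (by linarith [ht.2]) (by linarith) (by linarith) (by linarith)
    have hqn : ∀ t ∈ Icc 0 T, 0 ≤ q t := by
      intro t ht
      have := hun t ht
      simp only [hu, le_min_iff] at this
      exact this.1
    have hTT : T ∈ Icc 0 T := ⟨hT.1.le, le_rfl⟩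
    have hTNN : T ∈ Icc 0 N := ⟨hT.1.le, hTN⟩
    obtain ⟨-, b1, b2, b3⟩ := apriori hβ1 hβ2 ha hb1 hb2 hN.le hS hI hTN hqn T hTT
    have hq0 : q T = 0 := by
      refine le_antisymm ?_ (hqn T hTT)
      by_contra hc
      push Not at hc
      have : 0 < u T := by
        simp only [hu, lt_min_iff]
        refine ⟨hc, ?_, ?_, ?_⟩ <;> linarith
      linarith
    have hrle : r T ≤ 0 := left_deriv (hS T hTT).2.1 hT.1
      (fun x hx => by rw [hq0]; exact hqn x ⟨hx.1.le, hx.2.le⟩)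
    have hrne : r T ≠ 0 := by
      intro h
      have := uniq_left hT.1.le hS (m := 0) (by ring) hq0 h
      rw [hI.2.1] at this
      linarith
    have hrlt : r T < 0 := lt_of_le_of_ne hrle hrne
    have hev : ∀ᶠ x in 𝓝 T, |p x| < R ∧ |q x| < R ∧ |r x| < R ∧ x < N + 1 := by
      filter_upwards [(hcp T hTNN).abs.eventually (gt_mem_nhds (b1.trans_lt hBR)),
        (hcq T hTNN).abs.eventually (gt_mem_nhds (b2.trans_lt hBR)),
        (hcr T hTNN).abs.eventually (gt_mem_nhds (b3.trans_lt hBR)),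
        gt_mem_nhds (show T < N + 1 by linarith)] with x h1 h2 h3 h4 using ⟨h1, h2, h3, h4⟩
    obtain ⟨ε, hε, hball⟩ := Metric.eventually_nhds_iff.1 hev
    have hex : ∃ x ∈ Ioo T (T + ε), q x < 0 := by
      by_contra hc
      push Not at hc
      have := right_deriv (u := fun x => - q x) (hS T hTT).2.1.neg (show T < T + ε by linarith)
        (fun x hx => by rw [hq0]; linarith [hc x hx])
      linarith
    obtain ⟨x, hx, hqx⟩ := hex
    refine ⟨x, hT.1.trans hx.1, p, q, r, ?_, hI, hqx⟩
    intro t ht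
    rcases le_or_gt t T with h | h
    · exact hS t ⟨ht.1, h⟩
    · obtain ⟨g1, g2, g3, g4⟩ := hball (y := t) (by
        rw [Real.dist_eq, abs_of_pos (by linarith)]; linarith [ht.2, hx.2])
      exact hd t ⟨ht.1, g4.le⟩ g4 g1.le g2.le g3.le

lemma glue {β a b c : ℝ} (h : ∀ n : ℕ, ∃ p q r, Sol β p q r (n + 1) ∧ Ini a b c p q r ∧
      ∀ t ∈ Icc (0:ℝ) (n + 1), 0 < q t) :
    ∃ f, IsSolWithParam β a b c f ∧ ∀ t, 0 ≤ t → 0 < deriv f t := by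
  choose p q r hS hI hq using h
  have huq : ∀ m n : ℕ, ∀ t : ℝ, 0 ≤ t → t ≤ m + 1 → t ≤ n + 1 → 
      p m t = p n t ∧ q m t = q n t ∧ r m t = r n t := by
    intro m n t h0 h1 h2
    exact uniq ((hS m).mono h1) ((hS n).mono h2) ((hI m).1.trans (hI n).1.symm)
      ((hI m).2.1.trans (hI n).2.1.symm) ((hI m).2.2.trans (hI n).2.2.symm) t ⟨h0, le_rfl⟩
  set kk : ℕ → ℝ → ℝ := fun n t => -(p n t * r n t) + β * q n t * (1 - q n t) with hkk
  set k : ℝ → ℝ := fun t => kk ⌊max t 0⌋₊ (max t 0) with hk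
  have hkn : ∀ n : ℕ, ∀ t : ℝ, t ≤ n + 1 → k t = kk n (max t 0) := by
    intro n t ht
    obtain ⟨h1, h2, h3⟩ := huq ⌊max t 0⌋₊ n (max t 0) (le_max_right _ _) (Nat.lt_floor_add_one _).le
      (max_le ht (by positivity))
    simp only [hk, hkk, h1, h2, h3]
  have hkc : Continuous k := by
    rw [continuous_iff_continuousAt]
    intro t
    obtain ⟨n, hn⟩ := exists_nat_gt t
    have hn' : t < n + 1 := by linarith
    have hev : k =ᶠ[𝓝 t] fun s => kk n (max s 0) := by
      filter_upwards [gt_mem_nhds hn'] with s hs using hkn n s hs.le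
    refine ContinuousAt.congr ?_ hev.symm
    have hm : max t 0 ∈ Icc (0:ℝ) (n+1) := ⟨le_max_right _ _, max_le hn'.le (by positivity)⟩
    obtain ⟨d1, d2, d3⟩ := hS n _ hm
    have hkk' : ContinuousAt (kk n) (max t 0) := by
      have := d1.continuousAt; have := d2.continuousAt; have := d3.continuousAt
      simp only [hkk]
      fun_prop
    exact ContinuousAt.comp' hkk' (by fun_prop)
  have prim : ∀ g : ℝ → ℝ, Continuous g → ∀ y : ℝ, ∃ G : ℝ → ℝ, G 0 = y ∧ ∀ t, HasDerivAt G (g t) t := by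
    intro g hg y
    refine ⟨fun t => y + ∫ s in (0:ℝ)..t, g s, by simp, fun t => ?_⟩
    exact (intervalIntegral.integral_hasDerivAt_right (hg.intervalIntegrable _ _)
      (hg.stronglyMeasurableAtFilter _ _) hg.continuousAt).const_add y
  have hcd : ∀ {G g : ℝ → ℝ}, (∀ t, HasDerivAt G (g t) t) → Continuous G := fun hG =>
    continuous_iff_continuousAt.2 fun t => (hG t).continuousAt
  obtain ⟨r', hr0, hr⟩ := prim k hkc c
  obtain ⟨q', hq0, hq'⟩ := prim r' (hcd hr) b
  obtain ⟨f, hf0, hf⟩ := prim q' (hcd hq') a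
  have hdf : deriv f = q' := funext fun t => (hf t).deriv
  have hdq : deriv q' = r' := funext fun t => (hq' t).deriv
  have hdr : deriv r' = k := funext fun t => (hr t).deriv
  have eqv : ∀ (u v w w' : ℝ → ℝ) (T : ℝ), (∀ t ∈ Icc 0 T, HasDerivAt u (w t) t) →
      (∀ t, HasDerivAt v (w' t) t) → (∀ t ∈ Icc 0 T, w t = w' t) → u 0 = v 0 →
      ∀ t ∈ Icc 0 T, u t = v t := by
    intro u v w w' T hu hv hw h0 t ht
    have hd : ∀ t ∈ Icc 0 T, HasDerivAt (fun x => u x - v x) 0 t := fun t ht => by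
      have := (hu t ht).sub (hv t)
      rwa [hw t ht, sub_self] at this
    have e1 := grow (k := 0) hd (fun _ _ => le_rfl) 0 ⟨le_rfl, ht.1.trans ht.2⟩ t ht ht.1
    have e2 := growU (k := 0) hd (fun _ _ => le_rfl) 0 ⟨le_rfl, ht.1.trans ht.2⟩ t ht ht.1
    linarith
  have er : ∀ n : ℕ, ∀ t ∈ Icc (0:ℝ) (n+1), r n t = r' t := fun n =>
    eqv _ _ _ _ _ (fun t ht => (hS n t ht).2.2) hr (fun t ht => by
      rw [hkn n t ht.2, max_eq_left ht.1]) ((hI n).2.2.trans hr0.symm)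
  have eq : ∀ n : ℕ, ∀ t ∈ Icc (0:ℝ) (n+1), q n t = q' t := fun n =>
    eqv _ _ _ _ _ (fun t ht => (hS n t ht).2.1) hq' (er n) ((hI n).2.1.trans hq0.symm)
  have ep : ∀ n : ℕ, ∀ t ∈ Icc (0:ℝ) (n+1), p n t = f t := fun n =>
    eqv _ _ _ _ _ (fun t ht => (hS n t ht).1) hf (eq n) ((hI n).1.trans hf0.symm)
  refine ⟨f, ⟨?_, ?_, hf0, by rw [hdf, hq0], by rw [hdf, hdq, hr0]⟩, ?_⟩
  · have c1 : ContDiff ℝ 1 r' := contDiff_one_iff_deriv.2 ⟨fun t => (hr t).differentiableAt, hdr ▸ hkc⟩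
    have c2 : ContDiff ℝ (1 + 1) q' := contDiff_succ_iff_deriv.2
      ⟨fun t => (hq' t).differentiableAt, by simp, hdq ▸ c1⟩
    have c3 : ContDiff ℝ (1 + 1 + 1) f := contDiff_succ_iff_deriv.2
      ⟨fun t => (hf t).differentiableAt, by simp, hdf ▸ c2⟩
    have e : (3 : WithTop ℕ∞) = 1 + 1 + 1 := by norm_num
    rw [e]; exact c3
  · intro t ht
    obtain ⟨n, hn⟩ := exists_nat_gt t
    have hm : t ∈ Icc (0:ℝ) (n+1) := ⟨ht, by linarith⟩
    rw [hdf, hdq, hdr, hkn n t hm.2, max_eq_left hm.1]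
    simp only [hkk, er n t hm, eq n t hm, ep n t hm]
    ring
  · intro t ht
    obtain ⟨n, hn⟩ := exists_nat_gt t
    have hm : t ∈ Icc (0:ℝ) (n+1) := ⟨ht, by linarith⟩
    rw [hdf, ← eq n t hm]
    exact hq n t hm

/-- the "bad" parameters -/
def Bad (β a b c : ℝ) : Prop := ∃ T > 0, ∃ p q r, Sol β p q r T ∧ Ini a b c p q r ∧ q T < 0
/-- the "good" parameters -/
def Good (β a b c : ℝ) : Prop := ∃ f, IsSolWithParam β a b c f ∧ ∀ t, 0 ≤ t → 0 < deriv f t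

lemma dichotomy {β a b : ℝ} (hβ1 : 0 < β) (hβ2 : β ≤ 1) (ha : 0 ≤ a)
    (hb1 : 0 < b) (hb2 : b < 1) (c : ℝ) : Bad β a b c ∨ Good β a b c := by
  by_cases h : Bad β a b c
  · exact Or.inl h
  · right
    exact glue fun n => (step hβ1 hβ2 ha hb1 hb2 c (N := n + 1) (by positivity)).resolve_left h

lemma isSol_sol {β a b c : ℝ} {f : ℝ → ℝ} (h : IsSolWithParam β a b c f) (T : ℝ) :
    Sol β f (deriv f) (deriv (deriv f)) T := by
  obtain ⟨h1, h2, -⟩ := h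
  have e : (3 : WithTop ℕ∞) = 1 + 1 + 1 := by norm_num
  rw [e] at h1
  obtain ⟨d1, -, h3⟩ := contDiff_succ_iff_deriv.1 h1
  obtain ⟨d2, -, h4⟩ := contDiff_succ_iff_deriv.1 h3
  obtain ⟨d3, -⟩ := contDiff_one_iff_deriv.1 h4
  intro t ht
  refine ⟨(d1 t).hasDerivAt, (d2 t).hasDerivAt, ?_⟩
  have := (d3 t).hasDerivAt
  have e2 := h2 t ht.1
  have e3 : -(f t * deriv (deriv f) t) + β * deriv f t * (1 - deriv f t)
      = deriv (deriv (deriv f)) t := by linear_combination (-1) * e2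
  rw [e3]; exact this

lemma isSol_ini {β a b c : ℝ} {f : ℝ → ℝ} (h : IsSolWithParam β a b c f) :
    Ini a b c f (deriv f) (deriv (deriv f)) := h.2.2

end FS

namespace FS

/-- standing assumptions -/
structure Par (β a b : ℝ) : Prop where
  β1 : 0 < β
  β2 : β ≤ 1
  ha : 0 ≤ a
  b1 : 0 < b
  b2 : b < 1

lemma Sol.H {β : ℝ} {p q r : ℝ → ℝ} {T : ℝ} (h : Sol β p q r T) : ∀ t ∈ Icc 0 T,
    HasDerivAt (fun t => r t + p t * (q t - 1)) ((1 - β) * (q t * (q t - 1))) t := by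
  intro t ht
  obtain ⟨h1, h2, h3⟩ := h t ht
  have := h3.add (h1.mul (h2.sub_const 1))
  have e : (1 - β) * (q t * (q t - 1)) = -(p t * r t) + β * q t * (1 - q t)
      + (q t * (q t - 1) + p t * r t) := by ring
  rw [e]
  exact this

lemma lt_one {β a b c T : ℝ} (hP : Par β a b) {p q r : ℝ → ℝ} (hS : Sol β p q r T)
    (hI : Ini a b c p q r) (hc : c ≤ a * (1 - b)) (hq : ∀ t ∈ Icc 0 T, 0 ≤ q t) :
    ∀ t ∈ Icc 0 T, q t < 1 := by
  intro t ht
  by_contra hcon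
  push Not at hcon
  have hcq : ContinuousOn (fun t => 1 - q t) (Icc 0 t) :=
    continuousOn_const.sub (hS.cont.2.1.mono (Icc_subset_Icc le_rfl ht.2))
  obtain ⟨z, hz, hz0, hzp⟩ := first_zero hcq ht.1 (by simp only [hI.2.1]; linarith [hP.b2])
    (by linarith)
  have hzT : z ∈ Icc 0 T := ⟨hz.1.le, hz.2.trans ht.2⟩
  have hS' := hS.mono hzT.2
  have hqz : q z = 1 := by linarith
  have hH := growU (k := 0) hS'.H (fun x hx => by
    have h1 : q x ≤ 1 := by
      rcases hx.2.eq_or_lt with h | h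
      · rw [h, hqz]
      · linarith [hzp x ⟨hx.1, h⟩]
    have h2 := hq x ⟨hx.1, hx.2.trans hzT.2⟩
    have := hP.β2
    have h3 : q x * (q x - 1) ≤ 0 := mul_nonpos_of_nonneg_of_nonpos h2 (by linarith)
    exact mul_nonpos_of_nonneg_of_nonpos (by linarith) h3)
    0 ⟨le_rfl, hz.1.le⟩ z ⟨hz.1.le, le_rfl⟩ hz.1.le
  simp only [hI.1, hI.2.1, hI.2.2, hqz] at hH
  have hl := left_deriv ((hS z hzT).2.1.const_sub 1) hz.1 (fun x hx => by
    rw [hz0]; exact (hzp x ⟨hx.1.le, hx.2⟩).le)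
  have hr0 : r z = 0 := by
    apply le_antisymm <;> nlinarith
  have := uniq_left hz.1.le hS' (m := 1) (by ring) hqz hr0
  rw [hI.2.1] at this
  linarith [hP.b2]

lemma r_pos {β a b T s : ℝ} (hP : Par β a b) {p q r : ℝ → ℝ} (hS : Sol β p q r T) (hs : 0 ≤ s)
    (hqs : 0 < q s) (hrs : 0 ≤ r s) (hq : ∀ t ∈ Icc s T, q t < 1) : ∀ t ∈ Ioc s T, 0 < r t := by
  refine pos_of (fun t ht => (hS t ⟨hs.trans ht.1, ht.2⟩).2.2) hrs ?_
  intro t ht hn h0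
  have := grow (k := 0) (fun x (hx : x ∈ Icc s t) => (hS x ⟨hs.trans hx.1, hx.2.trans ht.2⟩).2.1) hn
    s ⟨le_rfl, ht.1⟩ t ⟨ht.1, le_rfl⟩ ht.1
  rw [h0, mul_zero, neg_zero, zero_add]
  exact mul_pos (mul_pos hP.β1 (by linarith)) (by linarith [hq t ht])

lemma gt_one {β a b T s : ℝ} (hP : Par β a b) {p q r : ℝ → ℝ} (hS : Sol β p q r T) (hs : 0 ≤ s)
    (hqs : q s = 1) (hrs : 0 < r s) : ∀ t ∈ Ioc s T, 1 < q t := by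
  intro t ht
  have := pos_of (u := fun t => q t - 1) (fun t ht => (hS t ⟨hs.trans ht.1, ht.2⟩).2.1.sub_const 1)
    (by rw [hqs]; simp) (fun t ht hn h0 => by
      have hH := grow (k := 0) (s := s) (T := t) (fun x hx => hS.H x ⟨hs.trans hx.1, hx.2.trans ht.2⟩)
        (fun x hx => by
          have h1 := hn x hx
          have := hP.β2
          exact mul_nonneg (by linarith) (mul_nonneg (by linarith) h1))
        s ⟨le_rfl, ht.1⟩ t ⟨ht.1, le_rfl⟩ ht.1
      have h1 : q t = 1 := by linarith
      simp only [h1, hqs] at hH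
      linarith) t ht
  linarith

/-- crossing structure for `c ≥ 0` -/
lemma cross {β a b c T : ℝ} (hP : Par β a b) {p q r : ℝ → ℝ} (hS : Sol β p q r T)
    (hI : Ini a b c p q r) (hc : 0 ≤ c) {t : ℝ} (ht : t ∈ Icc 0 T) (hqt : 1 ≤ q t) :
    ∃ z ∈ Ioc 0 T, z ≤ t ∧ q z = 1 ∧ (∀ x ∈ Ico 0 z, q x < 1) ∧ (∀ x ∈ Ioc 0 z, 0 < r x) ∧
      ∀ x ∈ Ioc z T, 1 < q x := by
  have hcq : ContinuousOn (fun t => 1 - q t) (Icc 0 t) :=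
    continuousOn_const.sub (hS.cont.2.1.mono (Icc_subset_Icc le_rfl ht.2))
  obtain ⟨z, hz, hz0, hzp⟩ := first_zero hcq ht.1 (by simp only [hI.2.1]; linarith [hP.b2])
    (by linarith)
  have hzT : z ∈ Icc 0 T := ⟨hz.1.le, hz.2.trans ht.2⟩
  have hqz : q z = 1 := by linarith
  have hS' := hS.mono hzT.2
  have hr1 : ∀ x ∈ Ioo 0 z, 0 < r x := fun x hx =>
    r_pos hP (hS.mono (hx.2.le.trans hzT.2)) le_rfl (by rw [hI.2.1]; exact hP.b1)
      (by rw [hI.2.2]; exact hc) (fun y hy => by linarith [hzp y ⟨hy.1, hy.2.trans_lt hx.2⟩]) x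
      ⟨hx.1, le_rfl⟩
  have hl := left_deriv ((hS z hzT).2.1.const_sub 1) hz.1 (fun x hx => by
    rw [hz0]; exact (hzp x ⟨hx.1.le, hx.2⟩).le)
  have hrz : 0 < r z := by
    refine lt_of_le_of_ne (by linarith) ?_
    intro h
    have := uniq_left hz.1.le hS' (m := 1) (by ring) hqz h.symm
    rw [hI.2.1] at this
    linarith [hP.b2]
  refine ⟨z, ⟨hz.1, hzT.2⟩, hz.2, hqz, fun x hx => by linarith [hzp x hx], ?_, 
    gt_one hP hS hzT.1 hqz hrz⟩
  intro x hx
  rcases hx.2.eq_or_lt with h | h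
  · rw [h]; exact hrz
  · exact hr1 x ⟨hx.1, h⟩

lemma ge_b {β a b c T : ℝ} (hP : Par β a b) {p q r : ℝ → ℝ} (hS : Sol β p q r T)
    (hI : Ini a b c p q r) (hc : 0 ≤ c) : ∀ t ∈ Icc 0 T, b ≤ q t := by
  have key : ∀ t ∈ Icc 0 T, (∀ x ∈ Ioc 0 t, 0 < r x) → b ≤ q t := by
    intro t ht h
    have := grow (k := 0) (hS.mono ht.2 · · |>.2.1) (fun x hx => by
      rcases hx.1.eq_or_lt with h' | h'
      · rw [← h', hI.2.2]; exact hc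
      · exact (h x ⟨h', hx.2⟩).le) 0 ⟨le_rfl, ht.1⟩ t ⟨ht.1, le_rfl⟩ ht.1
    rw [hI.2.1] at this
    linarith
  by_cases hex : ∃ t ∈ Icc 0 T, 1 ≤ q t
  · obtain ⟨t, ht, hqt⟩ := hex
    obtain ⟨z, hz, -, -, -, hr, hq⟩ := cross hP hS hI hc ht hqt
    intro x hx
    rcases le_or_gt x z with h | h
    · exact key x hx (fun y hy => hr y ⟨hy.1, hy.2.trans h⟩)
    · linarith [hq x ⟨h, hx.2⟩, hP.b2]
  · push Not at hex
    have hr := r_pos hP hS le_rfl (by rw [hI.2.1]; exact hP.b1) (by rw [hI.2.2]; exact hc) hex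
    intro t ht
    exact key t ht (fun y hy => hr y ⟨hy.1, hy.2.trans ht.2⟩)

lemma not_bad_of_nonneg {β a b c : ℝ} (hP : Par β a b) (hc : 0 ≤ c) : ¬ Bad β a b c := by
  rintro ⟨T, hT, p, q, r, hS, hI, hq⟩
  linarith [ge_b hP hS hI hc T ⟨hT.le, le_rfl⟩, hP.b1]

lemma good_of_not_bad {β a b c : ℝ} (hP : Par β a b) (h : ¬ Bad β a b c) : Good β a b c :=
  (dichotomy hP.β1 hP.β2 hP.ha hP.b1 hP.b2 c).resolve_left h

lemma bad_of_not_good {β a b c : ℝ} (hP : Par β a b) (h : ¬ Good β a b c) : Bad β a b c :=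
  (dichotomy hP.β1 hP.β2 hP.ha hP.b1 hP.b2 c).resolve_right h

lemma not_bad_of_good {β a b c : ℝ} (h : Good β a b c) : ¬ Bad β a b c := by
  rintro ⟨T, hT, p, q, r, hS, hI, hq⟩
  obtain ⟨f, hf, hfp⟩ := h
  have hI' := isSol_ini hf
  have := (uniq hS (isSol_sol hf T) (hI.1.trans hI'.1.symm) (hI.2.1.trans hI'.2.1.symm)
    (hI.2.2.trans hI'.2.2.symm) T ⟨hT.le, le_rfl⟩).2.1
  linarith [hfp T hT.le]

lemma bad_neg {β a b c : ℝ} (hP : Par β a b) (hc : c < 0) (h : Bad β a b c) :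
    ∃ T > 0, ∃ p q r, Sol β p q r T ∧ Ini a b c p q r ∧ q T = 0 ∧ (∀ t ∈ Ico 0 T, 0 < q t) ∧
      (∀ t ∈ Ico 0 T, r t < 0) := by
  obtain ⟨T', hT', p, q, r, hS', hI, hq⟩ := h
  obtain ⟨T, hT, hT0, hTp⟩ := first_zero hS'.cont.2.1 hT'.le (by rw [hI.2.1]; exact hP.b1) hq.le
  have hS := hS'.mono hT.2
  refine ⟨T, hT.1, p, q, r, hS, hI, hT0, hTp, ?_⟩
  have hq0 : ∀ t ∈ Icc 0 T, 0 ≤ q t := by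
    intro t ht
    rcases ht.2.eq_or_lt with h | h
    · rw [h, hT0]
    · exact (hTp t ⟨ht.1, h⟩).le
  have hq1 := lt_one hP hS hI (by nlinarith [mul_nonneg hP.ha (sub_nonneg.2 hP.b2.le)]) hq0
  intro s hs
  by_contra hcon
  push Not at hcon
  have hr := r_pos hP hS hs.1 (hTp s hs) hcon (fun t ht => hq1 t ⟨hs.1.trans ht.1, ht.2⟩)
  have := grow (k := 0) (s := s) (T := T) (fun x hx => (hS x ⟨hs.1.trans hx.1, hx.2⟩).2.1) (fun x hx => by
      rcases hx.1.eq_or_lt with h' | h'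
      · rw [← h']; exact hcon
      · exact (hr x ⟨h', hx.2⟩).le) s ⟨le_rfl, hs.2.le⟩ T ⟨hs.2.le, le_rfl⟩ hs.2.le
  linarith [hTp s hs]

lemma ev_ge {u u' : ℝ → ℝ} {T k : ℝ} (hk : 0 < k) (hu : ∀ t, T ≤ t → HasDerivAt u (u' t) t)
    (h : ∀ t, T ≤ t → k ≤ u' t) (M : ℝ) : ∃ T', T ≤ T' ∧ ∀ t, T' ≤ t → M ≤ u t := by
  refine ⟨T + |M - u T| / k, by have := abs_nonneg (M - u T); have : 0 ≤ |M - u T| / k := by positivity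
                                linarith, ?_⟩
  intro t ht
  have h0 : 0 ≤ |M - u T| / k := by positivity
  have := grow (s := T) (T := t) (fun x hx => hu x hx.1) (fun x hx => h x hx.1) T
    ⟨le_rfl, by linarith⟩ t ⟨by linarith, le_rfl⟩ (by linarith)
  have h2 : |M - u T| ≤ k * (t - T) := by
    rw [← div_le_iff₀' hk]; linarith
  linarith [le_abs_self (M - u T)]

lemma blowup {β a b : ℝ} (hP : Par β a b) {p q r : ℝ → ℝ} (hS : ∀ T, Sol β p q r T) {T : ℝ}
    (hT : 0 < T) (hq0 : 0 < q 0) (hqT : q T < 0) : False := by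
  have hd : ∀ t, 0 ≤ t → HasDerivAt p (q t) t ∧ HasDerivAt q (r t) t ∧
    HasDerivAt r (-(p t * r t) + β * q t * (1 - q t)) t := fun t ht => hS t t ⟨ht, le_rfl⟩
  have hβ := hP.β1
  -- a point with q < 0, r < 0
  obtain ⟨s, hs0, hqs, hrs⟩ : ∃ s, 0 < s ∧ q s < 0 ∧ r s < 0 := by
    by_contra hcon
    push Not at hcon
    have hcq : ContinuousOn (fun t => - q (T - t)) (Icc 0 T) := by
      refine (hS T).cont.2.1.neg.comp (f := fun t => T - t) (by fun_prop) ?_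
      intro t ht; exact ⟨by linarith [ht.2], by linarith [ht.1]⟩
    obtain ⟨z, hz, hz0, hzp⟩ := first_zero hcq hT.le (by simpa using hqT) (by simpa using hq0.le)
    have := grow (k := 0) (s := T - z) (T := T) (fun x hx => (hd x (by linarith [hz.2, hx.1])).2.1)
      (fun x hx => by
        rcases hx.1.eq_or_lt with h | h
        · rw [← h]
          have hd1 := (hd (T - z) (by linarith [hz.2])).2.1
          by_contra hneg
          push Not at hneg
          rcases hz.2.eq_or_lt with h' | h'
          · have e : T - z = 0 := by linarith
            rw [e] at hz0; linarith
          -- r < 0 at T - z : by continuity r < 0 slightly after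
          have hcr : ContinuousAt r (T - z) := (hd (T - z) (by linarith [hz.2])).2.2.continuousAt
          obtain ⟨ε, hε, hb⟩ := Metric.eventually_nhds_iff.1 (hcr.eventually (gt_mem_nhds hneg))
          have hm : 0 < min ε z := lt_min hε hz.1
          set y := T - z + min ε z / 2 with hy
          have h1 := hb (y := y) (by
            rw [Real.dist_eq, hy, abs_of_pos (by linarith)]; linarith [min_le_left ε z])
          have h2 := hzp (T - y) ⟨by linarith [min_le_right ε z], by linarith⟩
          have h3 := hcon y (by linarith) (by simpa using h2)
          linarith
        · have h2 := hzp (T - x) ⟨by linarith [hx.2], by linarith⟩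
          exact hcon x (by linarith [hz.2]) (by simpa using h2)) (T - z) ⟨le_rfl, by linarith [hz.1]⟩ T
        ⟨by linarith [hz.1], le_rfl⟩ (by linarith [hz.1])
    linarith
  have hqmono : ∀ t, s ≤ t → (∀ x ∈ Icc s t, r x ≤ 0) → q t ≤ q s := by
    intro t ht h
    have := growU (k := 0) (fun x (hx : x ∈ Icc s t) => (hd x (by linarith [hx.1])).2.1) h s ⟨le_rfl, ht⟩ t
      ⟨ht, le_rfl⟩ ht
    linarith
  have hr : ∀ t, s ≤ t → r t < 0 := by
    intro t ht
    rcases ht.eq_or_lt with h | h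
    · rw [← h]; exact hrs
    have := pos_of (u := fun t => - r t) (s := s) (T := t)
      (fun x hx => (hd x (by linarith [hx.1])).2.2.neg) (by linarith) (fun x hx hn h0 => by
        have h1 := hqmono x hx.1 (fun y hy => by linarith [hn y hy])
        have hr0 : r x = 0 := by linarith
        rw [hr0]
        have h2 : 0 < β * -q x * (1 - q x) := mul_pos (mul_pos hβ (by linarith)) (by linarith)
        linarith) t ⟨h, le_rfl⟩
    linarith
  have hq : ∀ t, s ≤ t → q t ≤ q s := fun t ht => hqmono t ht (fun x hx => (hr x hx.1).le)
  obtain ⟨t2, ht2, hp2⟩ := ev_ge (u := fun t => - p t) (k := - q s) (T := s) (by linarith)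
    (fun t ht => (hd t (by linarith)).1.neg) (fun t ht => by linarith [hq t ht]) 1
  obtain ⟨t3, ht3, hK⟩ := ev_ge (u := fun t => - r t - β * (p t * q t)) (T := t2) (k := β * (- q s))
    (mul_pos hβ (by linarith))
    (fun t ht => (hd t (by linarith)).2.2.neg.sub
      (((hd t (by linarith)).1.mul (hd t (by linarith)).2.1).const_mul β)) (fun t ht => by
        have h1 := hp2 t ht
        have h2 := hr t (by linarith)
        have h3 := hq t (by linarith)
        have h4 : 0 ≤ (1 - β) * (-p t * -r t) :=
          mul_nonneg (by linarith [hP.β2]) (mul_nonneg (by linarith) (by linarith))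
        have h5 : β * (- q s) ≤ β * (- q t) := mul_le_mul_of_nonneg_left (by linarith) hβ.le
        nlinarith) 1
  obtain ⟨t4, ht4, hJ⟩ := ev_ge (u := fun t => - q t - β / 2 * (p t * p t)) (T := t3) (k := 1)
    one_pos
    (fun t ht => (hd t (by linarith)).2.1.neg.sub
      (((hd t (by linarith)).1.mul (hd t (by linarith)).1).const_mul (β / 2))) (fun t ht => by
        have := hK t ht
        linarith) 0
  obtain ⟨t5, ht5, hF⟩ := ev_ge (u := fun t => (p t)⁻¹) (T := t4) (k := β / 2) (by linarith)
    (fun t ht => (hd t (by linarith)).1.inv (by have := hp2 t (by linarith); intro h; linarith))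
    (fun t ht => by
      have h1 := hp2 t (by linarith)
      have h2 := hJ t ht
      have h3 : 0 < p t ^ 2 := by nlinarith
      rw [le_div_iff₀ h3]
      nlinarith) 1
  have h1 := hF t5 le_rfl
  have h2 := hp2 t5 (by linarith)
  have : (p t5)⁻¹ < 0 := inv_lt_zero.2 (by linarith)
  linarith

lemma bad_no_sol {β a b c : ℝ} (hP : Par β a b) (h : Bad β a b c) :
    ¬ ∃ f, IsSolWithParam β a b c f := by
  rintro ⟨f, hf⟩
  obtain ⟨T, hT, p, q, r, hS, hI, hq⟩ := h
  have hI' := isSol_ini hf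
  have := (uniq hS (isSol_sol hf T) (hI.1.trans hI'.1.symm) (hI.2.1.trans hI'.2.1.symm)
    (hI.2.2.trans hI'.2.2.symm) T ⟨hT.le, le_rfl⟩).2.1
  exact blowup hP (fun T => isSol_sol hf T) hT (by rw [hI'.2.1]; exact hP.b1) (by rw [← this]; exact hq)

end FS

namespace FS

lemma lim_up {q r : ℝ → ℝ} {t0 M : ℝ} (hd : ∀ t, t0 ≤ t → HasDerivAt q (r t) t)
    (hr : ∀ t, t0 ≤ t → 0 ≤ r t) (hb : ∀ t, t0 ≤ t → q t ≤ M) :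
    ∃ L, Tendsto q atTop (𝓝 L) ∧ L ≤ M ∧ ∀ t, t0 ≤ t → q t ≤ L := by
  have hm : ∀ x y, t0 ≤ x → x ≤ y → q x ≤ q y := by
    intro x y hx hxy
    have := grow (k := 0) (s := x) (T := y) (fun t ht => hd t (hx.trans ht.1))
      (fun t ht => hr t (hx.trans ht.1)) x ⟨le_rfl, hxy⟩ y ⟨hxy, le_rfl⟩ hxy
    linarith
  have hmono : Monotone (fun t => q (max t t0)) := fun x y hxy =>
    hm _ _ (le_max_right _ _) (max_le_max_right _ hxy)
  have hbd : BddAbove (range (fun t => q (max t t0))) :=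
    ⟨M, by rintro _ ⟨t, rfl⟩; exact hb _ (le_max_right _ _)⟩
  have ht := tendsto_atTop_ciSup hmono hbd
  have ht' : Tendsto q atTop (𝓝 (⨆ t, q (max t t0))) := by
    refine ht.congr' ?_
    filter_upwards [eventually_ge_atTop t0] with t h
    simp only [max_eq_left h]
  refine ⟨_, ht', ?_, ?_⟩
  · exact ciSup_le (fun t => hb _ (le_max_right _ _))
  · intro t h
    have := le_ciSup hbd t
    simpa only [max_eq_left h] using this

lemma lim_dn {q r : ℝ → ℝ} {t0 M : ℝ} (hd : ∀ t, t0 ≤ t → HasDerivAt q (r t) t)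
    (hr : ∀ t, t0 ≤ t → r t ≤ 0) (hb : ∀ t, t0 ≤ t → M ≤ q t) :
    ∃ L, Tendsto q atTop (𝓝 L) ∧ M ≤ L ∧ ∀ t, t0 ≤ t → L ≤ q t := by
  obtain ⟨L, h1, h2, h3⟩ := lim_up (q := fun t => - q t) (r := fun t => - r t) (M := -M)
    (fun t ht => (hd t ht).neg) (fun t ht => by linarith [hr t ht]) (fun t ht => by linarith [hb t ht])
  refine ⟨-L, ?_, by linarith, fun t ht => by linarith [h3 t ht]⟩
  simpa using h1.neg

/-- derivative of `r + p (q - L)` -/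
lemma W_deriv {β L : ℝ} {p q r : ℝ → ℝ} {t : ℝ} (h : HasDerivAt p (q t) t ∧ HasDerivAt q (r t) t ∧
    HasDerivAt r (-(p t * r t) + β * q t * (1 - q t)) t) :
    HasDerivAt (fun t => r t + p t * (q t - L)) (β * q t * (1 - q t) + q t * (q t - L)) t := by
  have := h.2.2.add (h.1.mul (h.2.1.sub_const L))
  have e : β * q t * (1 - q t) + q t * (q t - L) = -(p t * r t) + β * q t * (1 - q t)
      + (q t * (q t - L) + p t * r t) := by ring
  rw [e]
  exact this

lemma W_lim {β L : ℝ} {q : ℝ → ℝ} (h : Tendsto q atTop (𝓝 L)) :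
    Tendsto (fun t => β * q t * (1 - q t) + q t * (q t - L)) atTop (𝓝 (β * L * (1 - L))) := by
  have := ((h.const_mul β).mul (h.const_sub 1)).add (h.mul (h.sub_const L))
  simpa using this

lemma as1 {β a b : ℝ} (hP : Par β a b) {p q r : ℝ → ℝ} {t0 : ℝ} (ht0 : 0 ≤ t0)
    (hS : ∀ T, Sol β p q r T)
    (hp : ∀ t, t0 ≤ t → 0 ≤ p t) (hr : ∀ t, t0 ≤ t → 0 ≤ r t) (hq0 : 0 < q t0)
    (hq : ∀ t, t0 ≤ t → q t ≤ 1) : Tendsto q atTop (𝓝 1) := by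
  have hd := fun t (ht : t0 ≤ t) => hS t t ⟨ht0.trans ht, le_rfl⟩
  obtain ⟨L, hL, hL1, hLq⟩ := lim_up (fun t ht => (hd t ht).2.1) hr hq
  rcases hL1.eq_or_lt with h | h
  · rwa [h] at hL
  exfalso
  have hLp : 0 < L := hq0.trans_le (hLq _ le_rfl)
  have hm : 0 < β * L * (1 - L) := mul_pos (mul_pos hP.β1 hLp) (by linarith)
  have hev := (W_lim (β := β) hL).eventually (lt_mem_nhds (half_lt_self hm))
  obtain ⟨t1, ht1⟩ := eventually_atTop.1 hev
  obtain ⟨t2, ht2, hW⟩ := ev_ge (T := max t0 t1) (half_pos hm)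
    (fun t ht => W_deriv (L := L) (hd t ((le_max_left _ _).trans ht)))
    (fun t ht => (ht1 t ((le_max_right _ _).trans ht)).le) 1
  have ht02 : t0 ≤ t2 := (le_max_left _ _).trans ht2
  obtain ⟨t3, ht3, hQ⟩ := ev_ge (T := t2) (k := 1) one_pos (fun t ht => (hd t (ht02.trans ht)).2.1)
    (fun t ht => by
      have h1 := hW t ht
      have h2 := mul_nonneg (hp t (ht02.trans ht)) (sub_nonneg.2 (hLq t (ht02.trans ht)))
      nlinarith) 2
  linarith [hQ t3 le_rfl, hq t3 (ht02.trans ht3)]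

lemma as2 {β a b : ℝ} (hP : Par β a b) {p q r : ℝ → ℝ}
    (hS : ∀ T, Sol β p q r T)
    (hp : ∀ t, 0 ≤ t → 0 ≤ p t) (hr : ∀ t, 0 ≤ t → r t ≤ 0) (hq0 : q 0 < 1)
    (hq : ∀ t, 0 ≤ t → 0 ≤ q t) : Tendsto q atTop (𝓝 0) := by
  have hd := fun t (ht : 0 ≤ t) => hS t t ⟨ht, le_rfl⟩
  obtain ⟨L, hL, hL1, hLq⟩ := lim_dn (fun t ht => (hd t ht).2.1) hr hq
  rcases hL1.eq_or_lt with h | h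
  · rwa [← h] at hL
  exfalso
  have hqd : ∀ t, 0 ≤ t → q t ≤ q 0 := by
    intro t ht
    have := growU (k := 0) (s := 0) (T := t) (fun x hx => (hd x hx.1).2.1)
      (fun x hx => hr x hx.1) 0 ⟨le_rfl, ht⟩ t ⟨ht, le_rfl⟩ ht
    linarith
  obtain ⟨t1, ht1, hR⟩ := ev_ge (T := 0) (k := β * L * (1 - q 0))
    (mul_pos (mul_pos hP.β1 h) (by linarith)) (fun t ht => (hd t ht).2.2)
    (fun t ht => by
      have h1 : 0 ≤ p t * (- r t) := mul_nonneg (hp t ht) (by linarith [hr t ht])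
      have h2 := mul_le_mul (mul_le_mul_of_nonneg_left (hLq t ht) hP.β1.le)
        (sub_le_sub_left (hqd t ht) 1) (by linarith) (mul_nonneg hP.β1.le (hq t ht))
      linarith) 1
  linarith [hR t1 le_rfl, hr t1 ht1]

lemma as3 {β a b : ℝ} (hP : Par β a b) {p q r : ℝ → ℝ} {t0 : ℝ} (ht0 : 0 ≤ t0)
    (hS : ∀ T, Sol β p q r T)
    (hp : ∀ t, t0 ≤ t → 0 ≤ p t) (hr : ∀ t, t0 ≤ t → r t ≤ 0)
    (hq : ∀ t, t0 ≤ t → 1 ≤ q t) : Tendsto q atTop (𝓝 1) := by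
  have hd := fun t (ht : t0 ≤ t) => hS t t ⟨ht0.trans ht, le_rfl⟩
  obtain ⟨L, hL, hL1, hLq⟩ := lim_dn (fun t ht => (hd t ht).2.1) hr hq
  rcases hL1.eq_or_lt with h | h
  · rwa [← h] at hL
  exfalso
  have hm : 0 < -(β * L * (1 - L)) := by
    have : 0 < β * L * (L - 1) := mul_pos (mul_pos hP.β1 (by linarith)) (by linarith)
    linarith
  have hev := (W_lim (β := β) hL).neg.eventually (lt_mem_nhds (half_lt_self hm))
  obtain ⟨t1, ht1⟩ := eventually_atTop.1 hev
  obtain ⟨t2, ht2, hW⟩ := ev_ge (T := max t0 t1) (half_pos hm)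
    (fun t ht => (W_deriv (L := L) (hd t ((le_max_left _ _).trans ht))).neg)
    (fun t ht => (ht1 t ((le_max_right _ _).trans ht)).le) 1
  have ht02 : t0 ≤ t2 := (le_max_left _ _).trans ht2
  obtain ⟨t3, ht3, hQ⟩ := ev_ge (T := t2) (k := 1) one_pos
    (fun t ht => (hd t (ht02.trans ht)).2.1.neg)
    (fun t ht => by
      have h1 := hW t ht
      have h2 := mul_nonneg (hp t (ht02.trans ht)) (sub_nonneg.2 (hLq t (ht02.trans ht)))
      simp only [Pi.neg_apply] at h1
      linarith) 2
  have h3 := hQ t3 le_rfl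
  simp only [Pi.neg_apply] at h3
  linarith [hq t3 (ht02.trans ht3)]

lemma as4 {β a b : ℝ} (hP : Par β a b) {p q r : ℝ → ℝ} {t1 : ℝ} (ht1 : 0 ≤ t1)
    (hS : ∀ T, Sol β p q r T) (hp : ∀ t, t1 ≤ t → 0 ≤ p t) (hq1 : 1 < q t1)
    (hr : ∀ t, t1 ≤ t → 0 ≤ r t) : False := by
  have hd := fun t (ht : t1 ≤ t) => hS t t ⟨ht1.trans ht, le_rfl⟩
  have hqd : ∀ t, t1 ≤ t → q t1 ≤ q t := by
    intro t ht
    have := grow (k := 0) (s := t1) (T := t) (fun x hx => (hd x hx.1).2.1)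
      (fun x hx => hr x hx.1) t1 ⟨le_rfl, ht⟩ t ⟨ht, le_rfl⟩ ht
    linarith
  obtain ⟨t2, ht2, hR⟩ := ev_ge (T := t1) (k := β * q t1 * (q t1 - 1))
    (mul_pos (mul_pos hP.β1 (by linarith)) (by linarith)) (fun t ht => (hd t ht).2.2.neg)
    (fun t ht => by
      have h0 := hqd t ht
      have h1 : 0 ≤ p t * r t := mul_nonneg (hp t ht) (hr t ht)
      have h2 := mul_le_mul (mul_le_mul_of_nonneg_left h0 hP.β1.le)
        (sub_le_sub_right h0 1) (by linarith) (mul_nonneg hP.β1.le (by linarith))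
      linarith) 1
  have h3 := hR t2 le_rfl
  simp only [Pi.neg_apply] at h3
  linarith [hr t2 ht2]

end FS

namespace FS

lemma inv_exists {q r : ℝ → ℝ} {T : ℝ} (hT : 0 < T) (hd : ∀ t ∈ Icc 0 T, HasDerivAt q (r t) t)
    (hc : ContinuousOn r (Icc 0 T)) (hr : ∀ t ∈ Icc 0 T, 0 < r t) :
    ∃ ψ : ℝ → ℝ, (∀ t ∈ Icc 0 T, ψ (q t) = t) ∧ ContinuousOn ψ (Icc (q 0) (q T)) ∧
      (∀ y ∈ Icc (q 0) (q T), ψ y ∈ Icc 0 T ∧ q (ψ y) = y) ∧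
      ∀ y ∈ Ioo (q 0) (q T), HasDerivAt ψ (r (ψ y))⁻¹ y := by
  obtain ⟨tm, htm, hmin⟩ := isCompact_Icc.exists_isMinOn (nonempty_Icc.2 hT.le) hc
  set m := r tm with hm
  have hm0 : 0 < m := hr tm htm
  have hg := grow hd (k := m) (fun t ht => hmin ht)
  have hqc : ContinuousOn q (Icc 0 T) := fun t ht => (hd t ht).continuousAt.continuousWithinAt
  have hsurj : ∀ y ∈ Icc (q 0) (q T), ∃ t, t ∈ Icc 0 T ∧ q t = y := fun y hy => by
    obtain ⟨t, ht, h⟩ := intermediate_value_Icc hT.le hqc hy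
    exact ⟨t, ht, h⟩
  have hdist : ∀ x ∈ Icc 0 T, ∀ y ∈ Icc 0 T, m * |x - y| ≤ |q x - q y| := by
    intro x hx y hy
    rcases le_total x y with h | h
    · have := hg x hx y hy h
      rw [abs_sub_comm x y, abs_sub_comm (q x), abs_of_nonneg (sub_nonneg.2 h)]
      exact (by linarith : m * (y - x) ≤ q y - q x).trans (le_abs_self _)
    · have := hg y hy x hx h
      rw [abs_of_nonneg (sub_nonneg.2 h)]
      exact (by linarith : m * (x - y) ≤ q x - q y).trans (le_abs_self _)
  classical
  choose! ψ hψ using hsurj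
  have hmono : ∀ t ∈ Icc 0 T, q t ∈ Icc (q 0) (q T) := by
    intro t ht
    have h1 := hg 0 ⟨le_rfl, hT.le⟩ t ht ht.1
    have h2 := hg t ht T ⟨hT.le, le_rfl⟩ ht.2
    have h3 : 0 ≤ m * (t - 0) := mul_nonneg hm0.le (by linarith [ht.1])
    have h4 : 0 ≤ m * (T - t) := mul_nonneg hm0.le (by linarith [ht.2])
    exact ⟨by linarith, by linarith⟩
  have hcont : ContinuousOn ψ (Icc (q 0) (q T)) := by
    have : LipschitzOnWith (Real.toNNReal m⁻¹) ψ (Icc (q 0) (q T)) := by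
      refine LipschitzOnWith.of_dist_le_mul fun x hx y hy => ?_
      rw [Real.coe_toNNReal _ (inv_nonneg.2 hm0.le), Real.dist_eq, Real.dist_eq]
      have := hdist _ (hψ x hx).1 _ (hψ y hy).1
      rw [(hψ x hx).2, (hψ y hy).2] at this
      rw [inv_mul_eq_div, le_div_iff₀ hm0]
      linarith
    exact this.continuousOn
  refine ⟨ψ, ?_, hcont, hψ, ?_⟩
  · intro t ht
    have h1 := hψ _ (hmono t ht)
    have h2 := hdist _ h1.1 _ ht
    rw [h1.2, sub_self, abs_zero] at h2
    have h3 : |ψ (q t) - t| ≤ 0 := by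
      by_contra h
      push Not at h
      linarith [mul_pos hm0 h]
    exact sub_eq_zero.1 (abs_nonpos_iff.1 h3)
  · intro y hy
    have hn : Icc (q 0) (q T) ∈ 𝓝 y := Icc_mem_nhds hy.1 hy.2
    have hy' := Ioo_subset_Icc_self hy
    exact HasDerivAt.of_local_left_inverse (hcont.continuousAt hn) (hd _ (hψ y hy').1)
      (hr _ (hψ y hy').1).ne' (by filter_upwards [hn] with x hx using (hψ x hx).2)

/-- abstract system used in the comparison -/
def Sys (χ κ : ℝ → ℝ) (p q r : ℝ → ℝ) (T : ℝ) : Prop :=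
  (∀ t ∈ Icc 0 T, HasDerivAt p (χ (q t)) t ∧ HasDerivAt q (r t) t ∧
    HasDerivAt r (-(p t * r t) + κ (q t)) t) ∧ ∀ t ∈ Icc 0 T, 0 < r t

lemma Sys.inv {χ κ p q r : ℝ → ℝ} {T t : ℝ} (h : Sys χ κ p q r T) (ht : t ∈ Ico 0 T) :
    ∃ Φ V : ℝ → ℝ, Φ (q 0) = p 0 ∧ V (q 0) = r 0 ∧ V (q t) = r t ∧
      ContinuousOn Φ (Icc (q 0) (q t)) ∧ ContinuousOn V (Icc (q 0) (q t)) ∧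
      (∀ y ∈ Icc (q 0) (q t), 0 < V y ∧ ∃ x ∈ Icc 0 T, q x = y) ∧
      ∀ y ∈ Ioc (q 0) (q t), HasDerivAt Φ (χ y / V y) y ∧ HasDerivAt V (- Φ y + κ y / V y) y := by
  obtain ⟨h, hr⟩ := h
  have hT : 0 < T := ht.1.trans_lt ht.2
  have hrc : ContinuousOn r (Icc 0 T) := fun t ht => (h t ht).2.2.continuousAt.continuousWithinAt
  have hpc : ContinuousOn p (Icc 0 T) := fun t ht => (h t ht).1.continuousAt.continuousWithinAt
  obtain ⟨ψ, h1, h2, h3, h4⟩ := inv_exists hT (fun t ht => (h t ht).2.1) hrc hr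
  have hsm : StrictMonoOn q (Icc 0 T) := by
    refine strictMonoOn_of_hasDerivWithinAt_pos (convex_Icc 0 T) (f' := r)
      (fun t ht => (h t ht).2.1.continuousAt.continuousWithinAt) (fun x hx => ?_) (fun x hx => ?_)
    · exact (h x (interior_subset hx)).2.1.hasDerivWithinAt
    · exact hr x (interior_subset hx)
  have hqt : q t < q T := hsm ⟨ht.1, ht.2.le⟩ ⟨hT.le, le_rfl⟩ ht.2
  have hsub : Icc (q 0) (q t) ⊆ Icc (q 0) (q T) := Icc_subset_Icc le_rfl hqt.le
  have hmaps : MapsTo ψ (Icc (q 0) (q t)) (Icc 0 T) := fun y hy => (h3 y (hsub hy)).1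
  refine ⟨p ∘ ψ, r ∘ ψ, ?_, ?_, ?_, hpc.comp (h2.mono hsub) hmaps, hrc.comp (h2.mono hsub) hmaps,
    ?_, ?_⟩
  · simp [h1 0 ⟨le_rfl, hT.le⟩]
  · simp [h1 0 ⟨le_rfl, hT.le⟩]
  · simp [h1 t ⟨ht.1, ht.2.le⟩]
  · intro y hy
    exact ⟨hr _ (hmaps hy), ψ y, hmaps hy, (h3 y (hsub hy)).2⟩
  · intro y hy
    have hy' : y ∈ Ioo (q 0) (q T) := ⟨hy.1, hy.2.trans_lt hqt⟩
    obtain ⟨h5, h6⟩ := h3 y (Ioo_subset_Icc_self hy')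
    have h7 := hr _ h5
    obtain ⟨d1, d2, d3⟩ := h _ h5
    have e1 := d1.comp y (h4 y hy')
    have e2 := d3.comp y (h4 y hy')
    rw [h6] at e1 e2
    refine ⟨?_, ?_⟩
    · rw [div_eq_mul_inv]; exact e1
    · have : - (p ∘ ψ) y + κ y / (r ∘ ψ) y = (-(p (ψ y) * r (ψ y)) + κ y) * (r (ψ y))⁻¹ := by
        simp only [Function.comp]
        field_simp
      rw [this]; exact e2

lemma comparison {χ κ p1 q1 r1 p2 q2 r2 : ℝ → ℝ} {T1 T2 t1 t2 : ℝ} (h1 : Sys χ κ p1 q1 r1 T1)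
    (h2 : Sys χ κ p2 q2 r2 T2) (hp : p1 0 = p2 0) (hq : q1 0 = q2 0) (hr : r1 0 < r2 0)
    (hχ : ∀ t ∈ Icc 0 T1, 0 < χ (q1 t)) (ht1 : t1 ∈ Ico 0 T1) (ht2 : t2 ∈ Ico 0 T2)
    (he : q1 t1 = q2 t2) :
    r1 t1 < r2 t2 ∧ ((∀ t ∈ Icc 0 T1, κ (q1 t) ≤ 0) → r1 t1 + (r2 0 - r1 0) ≤ r2 t2) := by
  obtain ⟨Φ, V, a1, a2, a3, a4, a5, a6, a7⟩ := h1.inv ht1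
  obtain ⟨Ψ, U, b1, b2, b3, b4, b5, b6, b7⟩ := h2.inv ht2
  rw [← hq] at b1 b2 b4 b5 b6 b7
  rw [← he] at b3 b4 b5 b6 b7
  set y0 := q1 0 with hy0
  set y1 := q1 t1 with hy1
  have hy01 : y0 ≤ y1 := by
    have := grow (k := 0) (fun t ht => (h1.1 t ht).2.1) (fun t ht => (h1.2 t ht).le) 0
      ⟨le_rfl, ht1.1.trans ht1.2.le⟩ t1 ⟨ht1.1, ht1.2.le⟩ ht1.1
    linarith
  have hχ' : ∀ y ∈ Icc y0 y1, 0 < χ y := by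
    intro y hy
    obtain ⟨-, x, hx, rfl⟩ := a6 y hy
    exact hχ x hx
  have hDd : ∀ y ∈ Ioc y0 y1, HasDerivAt (fun y => U y - V y)
      ((- Ψ y + κ y / U y) - (- Φ y + κ y / V y)) y := fun y hy => (b7 y hy).2.sub (a7 y hy).2
  have hDc : ContinuousOn (fun y => U y - V y) (Icc y0 y1) := b5.sub a5
  have hE : ∀ s ∈ Ioc y0 y1, (∀ x ∈ Ico y0 s, 0 < U x - V x) → Ψ s < Φ s := by
    intro s hs hpos
    have hsub : Icc y0 s ⊆ Icc y0 y1 := Icc_subset_Icc le_rfl hs.2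
    have : StrictMonoOn (fun y => Φ y - Ψ y) (Icc y0 s) := by
      refine strictMonoOn_of_hasDerivWithinAt_pos (convex_Icc y0 s)
        (f' := fun y => χ y / V y - χ y / U y)
        ((a4.sub b4).mono hsub) (fun x hx => ?_) (fun x hx => ?_)
      · rw [interior_Icc] at hx
        have hx' : x ∈ Ioc y0 y1 := ⟨hx.1, hx.2.le.trans hs.2⟩
        exact ((a7 x hx').1.sub (b7 x hx').1).hasDerivWithinAt
      · rw [interior_Icc] at hx
        have hx' : x ∈ Icc y0 y1 := ⟨hx.1.le, hx.2.le.trans hs.2⟩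
        have := hpos x ⟨hx.1.le, hx.2⟩
        exact sub_pos.2 (div_lt_div_of_pos_left (hχ' x hx') (a6 x hx').1 (by linarith))
    have := this ⟨le_rfl, hs.1.le⟩ ⟨hs.1.le, le_rfl⟩ hs.1
    simp only [a1, b1, hp, sub_self] at this
    linarith
  have hD : ∀ y ∈ Icc y0 y1, 0 < U y - V y := by
    intro y hy
    by_contra hcon
    push Not at hcon
    obtain ⟨s, hs, hs0, hsp⟩ := first_zero (hDc.mono (Icc_subset_Icc le_rfl hy.2)) hy.1
      (by rw [a2, b2]; linarith) hcon
    have hs' : s ∈ Ioc y0 y1 := ⟨hs.1, hs.2.trans hy.2⟩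
    have h3 := left_deriv (hDd s hs') hs.1 (fun x hx => by
      have := hsp x ⟨hx.1.le, hx.2⟩
      simp only [hs0]; exact this.le)
    have h4 := hE s hs' hsp
    have h5 : U s = V s := by linarith
    rw [h5] at h3
    linarith
  refine ⟨?_, ?_⟩
  · have := hD y1 ⟨hy01, le_rfl⟩
    rw [a3, b3] at this
    linarith
  · intro hκ
    have : MonotoneOn (fun y => U y - V y) (Icc y0 y1) := by
      refine monotoneOn_of_hasDerivWithinAt_nonneg (convex_Icc y0 y1)
        (f' := fun y => (- Ψ y + κ y / U y) - (- Φ y + κ y / V y)) hDc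
        (fun x hx => ?_) (fun x hx => ?_)
      · rw [interior_Icc] at hx
        exact (hDd x ⟨hx.1, hx.2.le⟩).hasDerivWithinAt
      · rw [interior_Icc] at hx
        have hx' : x ∈ Icc y0 y1 := ⟨hx.1.le, hx.2.le⟩
        have h3 := hE x ⟨hx.1, hx.2.le⟩ (fun z hz => hD z ⟨hz.1, hz.2.le.trans hx.2.le⟩)
        obtain ⟨hV, z, hz, hzx⟩ := a6 x hx'
        have hk := hκ z hz
        rw [hzx] at hk
        have h4 := hD x hx'
        have h5 : (-κ x) / U x ≤ (-κ x) / V x :=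
          div_le_div_of_nonneg_left (by linarith) hV (by linarith)
        rw [neg_div, neg_div] at h5
        linarith
    have := this ⟨le_rfl, hy01⟩ ⟨hy01, le_rfl⟩ hy01
    simp only [a2, b2, a3, b3] at this
    linarith

end FS

namespace FS

lemma BD_mono {a b c c' N : ℝ} (ha : 0 ≤ a) (hb : 0 < b) (hN : 0 ≤ N) (h : |c| ≤ |c'|) :
    BD a b c N ≤ BD a b c' N := by
  unfold BD BM
  gcongr

lemma near {β a b : ℝ} (hP : Par β a b) {c N : ℝ} (hN : 0 ≤ N) {p q r : ℝ → ℝ}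
    (hS : Sol β p q r N) (hI : Ini a b c p q r) :
    ∃ K > 0, ∀ c', |c' - c| ≤ 1 → ∀ p' q' r' : ℝ → ℝ, ∀ T, T ≤ N → Sol β p' q' r' T →
      Ini a b c' p' q' r' → (∀ t ∈ Icc 0 T, 0 ≤ q' t) →
      ∀ t ∈ Icc 0 T, |q t - q' t| ≤ K * |c' - c| ∧ |r t - r' t| ≤ K * |c' - c| := by
  obtain ⟨C, hC⟩ := hS.bdd
  obtain ⟨K, hK, h⟩ := gron β (max C (BD a b (|c| + 1) N)) N
  refine ⟨K, hK, ?_⟩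
  intro c' hc' p' q' r' T hT hS' hI' hq' t ht
  have hcc : |c'| ≤ |(|c| + 1)| := by
    rw [abs_of_nonneg (by positivity : (0:ℝ) ≤ |c| + 1)]
    have := abs_add_le c (c' - c)
    rw [show c + (c' - c) = c' by ring] at this
    linarith
  have hB := BD_mono (N := N) hP.ha hP.b1 hN hcc
  have ha' := apriori hP.β1 hP.β2 hP.ha hP.b1 hP.b2 hN hS' hI' hT hq'
  have := h p q r p' q' r' T hT (hS.mono hT) hS'
    (fun t ht => by
      obtain ⟨h1, h2, h3⟩ := hC t ⟨ht.1, ht.2.trans hT⟩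
      exact ⟨le_max_of_le_left h1, le_max_of_le_left h2, le_max_of_le_left h3⟩)
    (fun t ht => by
      obtain ⟨-, h1, h2, h3⟩ := ha' t ht
      exact ⟨le_max_of_le_right (h1.trans hB), le_max_of_le_right (h2.trans hB),
        le_max_of_le_right (h3.trans hB)⟩)
    (hI.1.trans hI'.1.symm) (hI.2.1.trans hI'.2.1.symm) t ht
  rw [hI.2.2, hI'.2.2, abs_sub_comm c c'] at this
  exact this

lemma small {K m x : ℝ} (hK : 0 < K) (h : |x| < min 1 (m / K)) : |x| ≤ 1 ∧ K * |x| < m := by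
  have h2 := h.trans_le (min_le_right _ _)
  rw [lt_div_iff₀ hK] at h2
  exact ⟨(h.trans_le (min_le_left _ _)).le, by linarith⟩

lemma bad_open {β a b c : ℝ} (hP : Par β a b) (h : Bad β a b c) :
    ∃ δ > 0, ∀ c', |c' - c| < δ → Bad β a b c' := by
  obtain ⟨T, hT, p, q, r, hS, hI, hq⟩ := h
  obtain ⟨K, hK, h⟩ := near hP hT.le hS hI
  refine ⟨min 1 (- q T / K), lt_min one_pos (div_pos (by linarith) hK), ?_⟩
  intro c' hc'
  obtain ⟨s1, s2⟩ := small hK hc'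
  refine bad_of_not_good hP ?_
  rintro ⟨f, hf, hfp⟩
  have := (h c' s1 _ _ _ T le_rfl (isSol_sol hf T) (isSol_ini hf) (fun t ht => (hfp t ht.1).le) T
    ⟨hT.le, le_rfl⟩).1
  have h2 := hfp T hT.le
  have h3 := abs_le.1 this
  linarith

lemma bad_low {β a b c : ℝ} (hP : Par β a b) (hc : c ≤ -(a * b + b + 2)) : Bad β a b c := by
  refine bad_of_not_good hP ?_
  rintro ⟨f, hf, hfp⟩
  have hS := isSol_sol hf 1
  have hI := isSol_ini hf
  have hab : 0 ≤ a * b := mul_nonneg hP.ha hP.b1.le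
  have hab' : 0 ≤ a * (1 - b) := mul_nonneg hP.ha (by linarith [hP.b2])
  have hq1 := lt_one hP hS hI (by linarith [hP.b1]) (fun t ht => (hfp t ht.1).le)
  have hp := apriori hP.β1 hP.β2 hP.ha hP.b1 hP.b2 zero_le_one hS hI le_rfl
    (fun t ht => (hfp t ht.1).le)
  have hG := growU (k := 1) (fun t ht => W_deriv (L := 0) (hS t ht)) (fun t ht => by
    have h1 := hq1 t ht
    have h2 := hfp t ht.1
    have h3 : 0 ≤ (1 - β) * (deriv f t * (1 - deriv f t)) :=
      mul_nonneg (by linarith [hP.β2]) (mul_nonneg h2.le (by linarith))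
    nlinarith)
  have hr : ∀ t ∈ Icc (0:ℝ) 1, deriv (deriv f) t ≤ -(b + 1) := by
    intro t ht
    have h1 := hG 0 ⟨le_rfl, zero_le_one⟩ t ht ht.1
    rw [hI.1, hI.2.1, hI.2.2] at h1
    have h2 : 0 ≤ f t * (deriv f t) := mul_nonneg (hP.ha.trans (hp t ht).1) (hfp t ht.1).le
    have := ht.2
    linarith
  have := growU (fun t ht => (hS t ht).2.1) hr 0 ⟨le_rfl, zero_le_one⟩ 1 ⟨zero_le_one, le_rfl⟩
    zero_le_one
  rw [hI.2.1] at this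
  linarith [hfp 1 zero_le_one]

lemma sys_neg {β b T : ℝ} {p q r : ℝ → ℝ} (hS : Sol β p q r T) (hr : ∀ t ∈ Icc 0 T, r t < 0) :
    Sys (fun z => - z) (fun z => β * z * (1 + z)) p (fun t => - q t) (fun t => - r t) T := by
  refine ⟨fun t ht => ?_, fun t ht => by linarith [hr t ht]⟩
  obtain ⟨h1, h2, h3⟩ := hS t ht
  refine ⟨by simpa using h1, h2.neg, ?_⟩
  have e : -(p t * -r t) + β * -q t * (1 + -q t) = - (-(p t * r t) + β * q t * (1 - q t)) := by ring
  rw [e]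
  exact h3.neg

lemma bad_mono {β a b c c' : ℝ} (hP : Par β a b) (hc : c < 0) (hcc : c' < c)
    (H : ∀ y ∈ Ioc 0 b, ∃ p q r : ℝ → ℝ, ∃ T, ∃ t ∈ Ico 0 T, Sol β p q r T ∧ Ini a b c p q r ∧
      q t = y ∧ ∀ x ∈ Icc 0 T, 0 < q x ∧ r x < 0) : Bad β a b c' := by
  refine bad_of_not_good hP ?_
  rintro ⟨f, hf, hfp⟩
  have hS := isSol_sol hf
  have hI := isSol_ini hf
  have key : ∀ T, ∀ x ∈ Ico 0 T, (∀ u ∈ Icc 0 T, deriv (deriv f) u < 0) →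
      deriv (deriv f) x ≤ -(c - c') := by
    intro T x hx hneg
    have hqb : deriv f x ≤ b := by
      have := growU (k := 0) (fun t ht => (hS T t ht).2.1) (fun t ht => (hneg t ht).le) 0
        ⟨le_rfl, hx.1.trans hx.2.le⟩ x ⟨hx.1, hx.2.le⟩ hx.1
      rw [hI.2.1] at this
      linarith
    obtain ⟨p, q, r, T1, t1, ht1, hS1, hI1, hy, hqr⟩ := H (deriv f x) ⟨hfp x hx.1, hqb⟩
    have hq1 : ∀ t ∈ Icc 0 T1, q t ≤ b := by
      intro t ht
      have := growU (k := 0) (fun t ht => (hS1 t ht).2.1) (fun t ht => (hqr t ht).2.le) 0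
        ⟨le_rfl, ht.1.trans ht.2⟩ t ht ht.1
      rw [hI1.2.1] at this
      linarith
    have := (comparison (sys_neg (b := b) hS1 (fun t ht => (hqr t ht).2))
      (sys_neg (b := b) (hS T) hneg)
      (hI1.1.trans hI.1.symm) (by simp only [hI1.2.1, hI.2.1])
      (by simp only [hI1.2.2, hI.2.2]; linarith) (fun t ht => by simpa using (hqr t ht).1)
      ht1 hx (by simp only [hy])).2 (fun t ht => by
        have h1 := (hqr t ht).1
        have h2 := hq1 t ht
        have h3 := hP.b2
        have := mul_nonneg (mul_nonneg hP.β1.le h1.le) (by linarith : 0 ≤ 1 - q t)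
        linarith)
    rw [hI1.2.2, hI.2.2] at this
    have h4 := (hqr t1 ⟨ht1.1, ht1.2.le⟩).2
    linarith
  have hneg : ∀ t, 0 ≤ t → deriv (deriv f) t < 0 := by
    intro t ht
    by_contra hcon
    push Not at hcon
    obtain ⟨s, hs, hs0, hsp⟩ := first_zero (u := fun t => - deriv (deriv f) t)
      (hS t).cont.2.2.neg ht (by simp only [hI.2.2]; linarith) (by linarith)
    have h1 : ∀ x ∈ Ico 0 s, deriv (deriv f) x ≤ -(c - c') := by
      intro x hx
      exact key ((x + s) / 2) x ⟨hx.1, by linarith [hx.2]⟩ (fun u hu => by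
        have := hsp u ⟨hu.1, by linarith [hu.2, hx.2]⟩
        linarith)
    have h2 : Tendsto (deriv (deriv f)) (𝓝[<] s) (𝓝 (deriv (deriv f) s)) :=
      ((hS s s ⟨hs.1.le, le_rfl⟩).2.2.continuousAt.tendsto).mono_left nhdsWithin_le_nhds
    have h3 := le_of_tendsto h2 (by
      filter_upwards [Ioo_mem_nhdsLT hs.1] with x hx using h1 x ⟨hx.1.le, hx.2⟩)
    linarith
  obtain ⟨t, ht, h⟩ := ev_ge (u := fun t => - deriv f t) (T := 0) (k := c - c') (by linarith)
    (fun t ht => (hS t t ⟨ht, le_rfl⟩).2.1.neg)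
    (fun t ht => by
      have := key (t + 1) t ⟨ht, by linarith⟩ (fun u hu => hneg u hu.1)
      linarith) 0
  have h1 := h t le_rfl
  have h2 := hfp t ht
  linarith

lemma bad_mono1 {β a b c c' : ℝ} (hP : Par β a b) (hcc : c' < c) (h : Bad β a b c) :
    Bad β a b c' := by
  have hc : c < 0 := by
    by_contra hcon
    exact not_bad_of_nonneg hP (not_lt.1 hcon) h
  obtain ⟨T, hT, p, q, r, hS, hI, hqT, hq, hr⟩ := bad_neg hP hc h
  refine bad_mono hP hc hcc fun y hy => ?_
  obtain ⟨t, ht, hty⟩ := intermediate_value_Icc' hT.le hS.cont.2.1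
    (show y ∈ Icc (q T) (q 0) by rw [hqT, hI.2.1]; exact ⟨hy.1.le, hy.2⟩)
  have htT : t < T := by
    rcases ht.2.eq_or_lt with h' | h'
    · rw [h', hqT] at hty; linarith [hy.1]
    · exact h'
  refine ⟨p, q, r, (t + T) / 2, t, ⟨ht.1, by linarith⟩, hS.mono (by linarith), hI, hty, ?_⟩
  intro x hx
  have : x ∈ Ico 0 T := ⟨hx.1, by linarith [hx.2]⟩
  exact ⟨hq x this, hr x this⟩

lemma good_p {β a b c : ℝ} (hP : Par β a b) {f : ℝ → ℝ} (hf : IsSolWithParam β a b c f)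
    (hfp : ∀ t, 0 ≤ t → 0 < deriv f t) : ∀ t, 0 ≤ t → 0 ≤ f t := fun t ht =>
  hP.ha.trans (apriori hP.β1 hP.β2 hP.ha hP.b1 hP.b2 ht (isSol_sol hf t) (isSol_ini hf) le_rfl
    (fun t ht => (hfp t ht.1).le) t ⟨ht, le_rfl⟩).1

lemma typeC_lim {β a b c : ℝ} (hP : Par β a b) {f : ℝ → ℝ} (hf : IsSolWithParam β a b c f)
    (hfp : ∀ t, 0 ≤ t → 0 < deriv f t) (hr : ∀ t, 0 ≤ t → deriv (deriv f) t < 0) :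
    Tendsto (deriv f) atTop (𝓝 0) :=
  as2 hP (isSol_sol hf) (good_p hP hf hfp) (fun t ht => (hr t ht).le)
    (by rw [(isSol_ini hf).2.1]; exact hP.b2) (fun t ht => (hfp t ht).le)

lemma bad_mono2 {β a b c c' : ℝ} (hP : Par β a b) (hcc : c' < c) {f : ℝ → ℝ}
    (hf : IsSolWithParam β a b c f)
    (hfp : ∀ t, 0 ≤ t → 0 < deriv f t) (hr : ∀ t, 0 ≤ t → deriv (deriv f) t < 0) :
    Bad β a b c' := by
  have hI := isSol_ini hf
  have hc : c < 0 := by rw [← hI.2.2]; exact hr 0 le_rfl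
  refine bad_mono hP hc hcc fun y hy => ?_
  have h1 := (typeC_lim hP hf hfp hr).eventually (gt_mem_nhds hy.1)
  obtain ⟨T, hTy, hT⟩ := (h1.and (eventually_ge_atTop 0)).exists
  obtain ⟨t, ht, hty⟩ := intermediate_value_Icc' hT (isSol_sol hf T).cont.2.1
    (show y ∈ Icc (deriv f T) (deriv f 0) by rw [hI.2.1]; exact ⟨hTy.le, hy.2⟩)
  exact ⟨f, deriv f, deriv (deriv f), t + 1, t, ⟨ht.1, by linarith⟩, isSol_sol hf _, hI, hty,
    fun x hx => ⟨hfp x hx.1, hr x hx.1⟩⟩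

lemma good_open {β a b c t : ℝ} (hP : Par β a b) {f : ℝ → ℝ}
    (hf : IsSolWithParam β a b c f)
    (hfp : ∀ t, 0 ≤ t → 0 < deriv f t) (ht : 0 < t) (hr : 0 < deriv (deriv f) t) :
    ∃ δ > 0, ∀ c' < 0, |c' - c| < δ → ¬ Bad β a b c' := by
  have hS := isSol_sol hf t
  obtain ⟨K, hK, h⟩ := near hP ht.le hS (isSol_ini hf)
  obtain ⟨tm, htm, hmin⟩ := isCompact_Icc.exists_isMinOn (nonempty_Icc.2 ht.le) hS.cont.2.1
  have hm : 0 < deriv f tm := hfp tm htm.1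
  refine ⟨min 1 (min (deriv f tm) (deriv (deriv f) t) / K),
    lt_min one_pos (div_pos (lt_min hm hr) hK), ?_⟩
  intro c' hc' hcc hbad
  obtain ⟨s1, s2⟩ := small hK hcc
  obtain ⟨T, hT, p, q, r, hS', hI', hqT, hq, hr'⟩ := bad_neg hP hc' hbad
  have hq0 : ∀ x ∈ Icc 0 T, 0 ≤ q x := by
    intro x hx
    rcases hx.2.eq_or_lt with h' | h'
    · rw [h', hqT]
    · exact (hq x ⟨hx.1, h'⟩).le
  rcases lt_or_ge t T with h' | h'
  · have h1 := (h c' s1 p q r t le_rfl (hS'.mono h'.le) hI'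
      (fun x hx => hq0 x ⟨hx.1, hx.2.trans h'.le⟩) t ⟨ht.le, le_rfl⟩).2
    have h2 := hr' t ⟨ht.le, h'⟩
    have h3 := abs_le.1 h1
    have := min_le_right (deriv f tm) (deriv (deriv f) t)
    linarith
  · have h1 := (h c' s1 p q r T h' hS' hI' hq0 T ⟨hT.le, le_rfl⟩).1
    have h2 : deriv f tm ≤ deriv f T := hmin ⟨hT.le, h'⟩
    have h3 := abs_le.1 h1
    have := min_le_left (deriv f tm) (deriv (deriv f) t)
    linarith

/-- crossing parameters -/
def X (β a b : ℝ) : Set ℝ := {c | 0 ≤ c ∧ ∃ f, IsSolWithParam β a b c f ∧ ∃ t, 0 ≤ t ∧ 1 ≤ deriv f t}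

lemma X_gt {β a b c : ℝ} (hP : Par β a b) (h : c ∈ X β a b) : a * (1 - b) < c := by
  obtain ⟨hc, f, hf, t, ht, h1⟩ := h
  by_contra hcon
  have hI := isSol_ini hf
  have := lt_one hP (isSol_sol hf t) hI (not_lt.1 hcon)
    (fun x hx => hP.b1.le.trans (ge_b hP (isSol_sol hf t) hI hc x hx)) t ⟨ht, le_rfl⟩
  linarith

lemma X_ne {β a b : ℝ} (hP : Par β a b) : a + 3 ∈ X β a b := by
  have hc : 0 ≤ a + 3 := by linarith [hP.ha]
  obtain ⟨f, hf, hfp⟩ := good_of_not_bad hP (not_bad_of_nonneg hP hc)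
  refine ⟨hc, f, hf, ?_⟩
  by_contra hcon
  push Not at hcon
  have hS := isSol_sol hf 1
  have hI := isSol_ini hf
  have hab : 0 ≤ a * b := mul_nonneg hP.ha hP.b1.le
  have hp := growU (k := 1) (fun t ht => (hS t ht).1) (fun t ht => (hcon t ht.1).le)
  have hG := grow (k := 0) (fun t ht => W_deriv (L := 0) (hS t ht)) (fun t ht => by
    have h1 := hcon t ht.1
    have h2 := hfp t ht.1
    have h3 : 0 ≤ β * deriv f t * (1 - deriv f t) :=
      mul_nonneg (mul_nonneg hP.β1.le h2.le) (by linarith)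
    nlinarith)
  have hr : ∀ t ∈ Icc (0:ℝ) 1, 2 ≤ deriv (deriv f) t := by
    intro t ht
    have h1 := hG 0 ⟨le_rfl, zero_le_one⟩ t ht ht.1
    have h2 := hp 0 ⟨le_rfl, zero_le_one⟩ t ht ht.1
    rw [hI.1, hI.2.1, hI.2.2] at h1
    rw [hI.1] at h2
    have h3 : f t * (deriv f t) ≤ (a + 1) * 1 :=
      mul_le_mul (by linarith [ht.2]) (hcon t ht.1).le (hfp t ht.1).le (by linarith [hP.ha])
    linarith
  have := grow (fun t ht => (hS t ht).2.1) hr 0 ⟨le_rfl, zero_le_one⟩ 1 ⟨zero_le_one, le_rfl⟩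
    zero_le_one
  rw [hI.2.1] at this
  linarith [hcon 1 zero_le_one, hP.b1]

lemma X_open {β a b c : ℝ} (hP : Par β a b) (h : c ∈ X β a b) : ∃ c' ∈ X β a b, c' < c := by
  have hc0 : 0 < c := (mul_nonneg hP.ha (by linarith [hP.b2])).trans_lt (X_gt hP h)
  obtain ⟨hc, f, hf, t, ht, h1⟩ := h
  have hS := isSol_sol hf (t + 1)
  have hI := isSol_ini hf
  obtain ⟨z, hz, hzt, -, -, -, hgt⟩ := cross hP hS hI hc ⟨ht, by linarith⟩ h1
  have hq := hgt (t + 1) ⟨by linarith, le_rfl⟩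
  obtain ⟨K, hK, h⟩ := near hP (by linarith) hS hI
  set δ := min 1 ((deriv f (t + 1) - 1) / K) with hδ
  have hδ0 : 0 < δ := lt_min one_pos (div_pos (by linarith) hK)
  set e := min c (δ / 2) with he
  have he0 : 0 < e := lt_min hc0 (by linarith)
  have hec : e ≤ c := min_le_left _ _
  have heδ : e ≤ δ / 2 := min_le_right _ _
  have hab : |(c - e) - c| < δ := by
    rw [show c - e - c = - e by ring, abs_neg, abs_of_pos he0]; linarith
  obtain ⟨s1, s2⟩ := small hK hab
  obtain ⟨g, hg, hgp⟩ := good_of_not_bad hP (not_bad_of_nonneg hP (sub_nonneg.2 hec))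
  refine ⟨c - e, ⟨by linarith, g, hg, t + 1, by linarith, ?_⟩, by linarith⟩
  have h2 := (h (c - e) s1 _ _ _ (t + 1) le_rfl (isSol_sol hg _) (isSol_ini hg)
    (fun x hx => (hgp x hx.1).le) (t + 1) ⟨by linarith, le_rfl⟩).1
  have := abs_le.1 h2
  linarith

lemma X_up {β a b c c' : ℝ} (hP : Par β a b) (h : c ∈ X β a b) (hcc : c < c') : c' ∈ X β a b := by
  have hc0 : 0 < c := (mul_nonneg hP.ha (by linarith [hP.b2])).trans_lt (X_gt hP h)
  obtain ⟨hc, f, hf, t, ht, h1⟩ := h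
  have hI := isSol_ini hf
  obtain ⟨g, hg, hgp⟩ := good_of_not_bad hP (not_bad_of_nonneg hP (by linarith : 0 ≤ c'))
  have hJ := isSol_ini hg
  refine ⟨by linarith, g, hg, ?_⟩
  by_contra hcon
  push Not at hcon
  obtain ⟨z, hz, hzt, hqz, -, hrz, -⟩ := cross hP (isSol_sol hf t) hI hc ⟨ht, le_rfl⟩ h1
  have hS := isSol_sol hf z
  have hrz' : ∀ x ∈ Icc 0 z, 0 < deriv (deriv f) x := by
    intro x hx
    rcases hx.1.eq_or_lt with h' | h'
    · rw [← h', hI.2.2]; exact hc0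
    · exact hrz x ⟨h', hx.2⟩
  have hrg : ∀ x, 0 ≤ x → 0 < deriv (deriv g) x := by
    intro x hx
    rcases hx.eq_or_lt with h' | h'
    · rw [← h', hJ.2.2]; linarith
    · exact r_pos hP (isSol_sol hg x) le_rfl (hgp 0 le_rfl) (by rw [hJ.2.2]; linarith)
        (fun t ht => hcon t ht.1) x ⟨h', le_rfl⟩
  obtain ⟨tm, htm, hmin⟩ := isCompact_Icc.exists_isMinOn (nonempty_Icc.2 hz.1.le) hS.cont.2.2
  have hm := hrz' tm htm
  obtain ⟨s, hs, hs2⟩ := ev_ge (u := deriv g) (T := 0) hm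
    (fun t ht => (isSol_sol hg t t ⟨ht, le_rfl⟩).2.1) (fun x hx => by
      have hbg := ge_b hP (isSol_sol hg x) hJ (by linarith) x ⟨hx, le_rfl⟩
      obtain ⟨u, hu, huy⟩ := intermediate_value_Icc hz.1.le hS.cont.2.1
        (show deriv g x ∈ Icc (deriv f 0) (deriv f z) by
          rw [hqz, hI.2.1]; exact ⟨hbg, (hcon x hx).le⟩)
      have huz : u < z := by
        rcases hu.2.eq_or_lt with h' | h'
        · rw [h', hqz] at huy; linarith [hcon x hx]
        · exact h'
      have := (comparison (χ := fun y => y) (κ := fun y => β * y * (1 - y))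
        (T1 := z) (T2 := x + 1) (t1 := u) (t2 := x)
        ⟨fun t ht => hS t ht, hrz'⟩ ⟨fun t ht => isSol_sol hg (x + 1) t ht, fun t ht => hrg t ht.1⟩
        (hI.1.trans hJ.1.symm) (hI.2.1.trans hJ.2.1.symm) (by rw [hI.2.2, hJ.2.2]; exact hcc)
        (fun t ht => hP.b1.trans_le (ge_b hP hS hI hc t ht)) ⟨hu.1, huz⟩ ⟨hx, by linarith⟩ huy).1
      exact (hmin hu).trans this.le) 1
  linarith [hs2 s le_rfl, hcon s hs]

end FS

namespace FS

lemma later_pos {β a b c s : ℝ} (hP : Par β a b) {f : ℝ → ℝ} (hf : IsSolWithParam β a b c f)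
    (hfp : ∀ t, 0 ≤ t → 0 < deriv f t) (hc : c ≤ 0) (hs : 0 ≤ s) (h : 0 ≤ deriv (deriv f) s) :
    ∀ t, s < t → 0 < deriv (deriv f) t := by
  intro t ht
  have hab' : 0 ≤ a * (1 - b) := mul_nonneg hP.ha (by linarith [hP.b2])
  exact r_pos hP (isSol_sol hf t) hs (hfp s hs) h
    (fun x hx => lt_one hP (isSol_sol hf x) (isSol_ini hf) (by linarith)
      (fun y hy => (hfp y hy.1).le) x ⟨hs.trans hx.1, le_rfl⟩) t ⟨ht, le_rfl⟩

lemma part_low {β a b : ℝ} (hP : Par β a b) : ∃ cs, cs < 0 ∧ (∀ c < cs, Bad β a b c) ∧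
    (∀ c, cs < c → ¬ Bad β a b c) ∧ ∃ f, IsSolWithParam β a b cs f ∧
    (∀ t, 0 ≤ t → 0 < deriv f t) ∧ ∀ t, 0 ≤ t → deriv (deriv f) t < 0 := by
  set S := {c | Bad β a b c} with hSd
  have hne : S.Nonempty := ⟨_, bad_low hP le_rfl⟩
  have hneg : ∀ c ∈ S, c < 0 := fun c hc => by
    by_contra hcon
    exact not_bad_of_nonneg hP (not_lt.1 hcon) hc
  have hbdd : BddAbove S := ⟨0, fun c hc => (hneg c hc).le⟩
  have hs0 : sSup S ≤ 0 := csSup_le hne (fun c hc => (hneg c hc).le)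
  have hab : ∀ c, sSup S < c → ¬ Bad β a b c := fun c hc hb =>
    absurd (le_csSup hbdd hb) (not_le.2 hc)
  have hnb : ¬ Bad β a b (sSup S) := by
    intro hb
    obtain ⟨δ, hδ, h⟩ := bad_open hP hb
    refine hab (sSup S + δ / 2) (by linarith) (h _ ?_)
    rw [add_sub_cancel_left, abs_of_pos (by linarith)]
    linarith
  obtain ⟨f, hf, hfp⟩ := good_of_not_bad hP hnb
  have hr : ∀ t, 0 ≤ t → deriv (deriv f) t < 0 := by
    intro s hs
    by_contra hcon
    have h1 := later_pos hP hf hfp hs0 hs (not_lt.1 hcon) (s + 1) (by linarith)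
    obtain ⟨δ, hδ, h⟩ := good_open hP hf hfp (by linarith : 0 < s + 1) h1
    obtain ⟨c, hc, hlt⟩ := exists_lt_of_lt_csSup hne (by linarith : sSup S - δ < sSup S)
    refine h c (hneg c hc) ?_ hc
    rw [abs_lt]
    exact ⟨by linarith, by linarith [le_csSup hbdd hc]⟩
  refine ⟨sSup S, ?_, ?_, hab, f, hf, hfp, hr⟩
  · have := hr 0 le_rfl
    rwa [(isSol_ini hf).2.2] at this
  · intro c hc
    exact bad_mono2 hP hc hf hfp hr

lemma part_iii {β a b c cs : ℝ} (hP : Par β a b) (hab : ∀ c, cs < c → ¬ Bad β a b c)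
    (h1 : cs < c) (h2 : c < 0) : ∃ f : ℝ → ℝ, IsSolWithParam β a b c f ∧
        ∃ t₀ > 0, (∀ t ∈ Ioo 0 t₀, deriv (deriv f) t < 0) ∧
          (∀ t ∈ Ioi t₀, 0 < deriv (deriv f) t) ∧
          Tendsto (deriv f) atTop (𝓝 1) := by
  obtain ⟨f, hf, hfp⟩ := good_of_not_bad hP (hab c h1)
  have hI := isSol_ini hf
  have hab' : 0 ≤ a * (1 - b) := mul_nonneg hP.ha (by linarith [hP.b2])
  refine ⟨f, hf, ?_⟩
  obtain ⟨s, hs, hrs⟩ : ∃ s, 0 ≤ s ∧ 0 ≤ deriv (deriv f) s := by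
    by_contra hcon
    push Not at hcon
    exact hab ((cs + c) / 2) (by linarith) (bad_mono2 hP (by linarith) hf hfp hcon)
  obtain ⟨z, hz, hz0, hzp⟩ := first_zero (u := fun t => - deriv (deriv f) t)
    (isSol_sol hf s).cont.2.2.neg hs (by simp only [hI.2.2]; linarith) (by linarith)
  have hz0' : deriv (deriv f) z = 0 := by linarith
  have hlp := later_pos hP hf hfp h2.le hz.1.le hz0'.ge
  refine ⟨z, hz.1, fun t ht => by linarith [hzp t ⟨ht.1.le, ht.2⟩], hlp, ?_⟩
  refine as1 hP hz.1.le (isSol_sol hf) (fun t ht => good_p hP hf hfp t (hz.1.le.trans ht)) ?_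
    (hfp z hz.1.le) ?_
  · intro t ht
    rcases ht.eq_or_lt with h | h
    · rw [← h, hz0']
    · exact (hlp t h).le
  · intro t ht
    exact (lt_one hP (isSol_sol hf t) hI (by linarith)
      (fun y hy => (hfp y hy.1).le) t ⟨hz.1.le.trans ht, le_rfl⟩).le

lemma part_iv {β a b c : ℝ} (hP : Par β a b) (hc : 0 ≤ c) (hX : c ∉ X β a b) :
    ∃ f : ℝ → ℝ, IsSolWithParam β a b c f ∧
        (∀ t ∈ Ici (0 : ℝ), 0 ≤ deriv (deriv f) t ∧ b ≤ deriv f t ∧ deriv f t ≤ 1) ∧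
        Tendsto (deriv f) atTop (𝓝 1) := by
  obtain ⟨f, hf, hfp⟩ := good_of_not_bad hP (not_bad_of_nonneg hP hc)
  have hI := isSol_ini hf
  have hq : ∀ t, 0 ≤ t → deriv f t < 1 := by
    intro t ht
    by_contra hcon
    exact hX ⟨hc, f, hf, t, ht, not_lt.1 hcon⟩
  have hr : ∀ t, 0 ≤ t → 0 ≤ deriv (deriv f) t := by
    intro t ht
    rcases ht.eq_or_lt with h | h
    · rw [← h, hI.2.2]; exact hc
    · exact (r_pos hP (isSol_sol hf t) le_rfl (hfp 0 le_rfl) (by rw [hI.2.2]; exact hc)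
        (fun x hx => hq x hx.1) t ⟨h, le_rfl⟩).le
  exact ⟨f, hf, fun t ht => ⟨hr t ht, ge_b hP (isSol_sol hf t) hI hc t ⟨ht, le_rfl⟩, (hq t ht).le⟩,
    as1 hP le_rfl (isSol_sol hf) (good_p hP hf hfp) hr (hfp 0 le_rfl) (fun t ht => (hq t ht).le)⟩

lemma part_v {β a b c : ℝ} (hP : Par β a b) (hX : c ∈ X β a b) :
    ∃ f : ℝ → ℝ, IsSolWithParam β a b c f ∧
        ∃ t₀ > 0, (∀ t ∈ Ico 0 t₀, 0 < deriv (deriv f) t) ∧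
          (∀ t ∈ Ioi t₀, deriv (deriv f) t < 0) ∧
          Tendsto (deriv f) atTop (𝓝 1) := by
  have hc0 : 0 < c := (mul_nonneg hP.ha (by linarith [hP.b2])).trans_lt (X_gt hP hX)
  obtain ⟨hc, f, hf, t, ht, h1⟩ := hX
  have hI := isSol_ini hf
  have hS := isSol_sol hf
  have hfp : ∀ t, 0 ≤ t → 0 < deriv f t := fun t ht =>
    hP.b1.trans_le (ge_b hP (hS t) hI hc t ⟨ht, le_rfl⟩)
  have hp := good_p hP hf hfp
  obtain ⟨z, hz, hzt, hqz, -, hrz, -⟩ := cross hP (hS t) hI hc ⟨ht, le_rfl⟩ h1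
  have hrz' : ∀ x ∈ Icc 0 z, 0 < deriv (deriv f) x := by
    intro x hx
    rcases hx.1.eq_or_lt with h' | h'
    · rw [← h', hI.2.2]; exact hc0
    · exact hrz x ⟨h', hx.2⟩
  have hq1 : ∀ x, z < x → 1 < deriv f x := fun x hx =>
    gt_one hP (hS x) hz.1.le hqz (hrz z ⟨hz.1, le_rfl⟩) x ⟨hx, le_rfl⟩
  have hz0 := hz.1
  obtain ⟨s, hs, hrs⟩ : ∃ s, z + 1 ≤ s ∧ deriv (deriv f) s < 0 := by
    by_contra hcon
    push Not at hcon
    exact as4 hP (by linarith : 0 ≤ z + 1) hS (fun t ht => hp t (by linarith))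
      (hq1 _ (by linarith)) hcon
  obtain ⟨w, hw, hw0, hwp⟩ := first_zero (hS s).cont.2.2 (by linarith)
    (by rw [hI.2.2]; exact hc0) hrs.le
  have hzw : z < w := by
    by_contra hcon
    have := hrz' w ⟨hw.1.le, not_lt.1 hcon⟩
    linarith
  have hneg : ∀ t ∈ Ioi w, deriv (deriv f) t < 0 := by
    intro t ht
    have := pos_of (u := fun t => - deriv (deriv f) t) (s := w) (T := t)
      (fun x hx => (hS x x ⟨hw.1.le.trans hx.1, le_rfl⟩).2.2.neg) (by simp only [hw0, neg_zero, le_refl])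
      (fun x hx _ h0 => by
        have h2 : deriv (deriv f) x = 0 := by linarith
        have h3 := hq1 x (hzw.trans_le hx.1)
        rw [h2]
        have : 0 < β * deriv f x * (deriv f x - 1) :=
          mul_pos (mul_pos hP.β1 (by linarith)) (by linarith)
        linarith) t ⟨ht, le_rfl⟩
    linarith
  refine ⟨f, hf, w, hw.1, hwp, hneg, ?_⟩
  refine as3 hP hw.1.le hS (fun t ht => hp t (hw.1.le.trans ht)) ?_
    (fun t ht => (hq1 t (hzw.trans_le ht)).le)
  intro t ht
  rcases ht.eq_or_lt with h | h
  · rw [← h, hw0]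
  · exact (hneg t h).le

end FS

/-- full shooting description for `β ∈ (0,1]`, `a ≥ 0`, `b ∈ (0,1)`. -/
theorem stmt16 (β a b : ℝ) (hβ1 : 0 < β) (hβ2 : β ≤ 1) (ha : 0 ≤ a)
    (hb1 : 0 < b) (hb2 : b < 1) :
    ∃ cs cstar : ℝ, cs < 0 ∧ a * (1 - b) ≤ cstar ∧
      (∀ c < cs, ¬ ∃ f : ℝ → ℝ, IsSolWithParam β a b c f) ∧
      (∃ f : ℝ → ℝ, IsSolWithParam β a b cs f ∧
        (∀ t ∈ Ici (0 : ℝ), deriv (deriv f) t < 0) ∧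
        Tendsto (deriv f) atTop (𝓝 0)) ∧
      (∀ c : ℝ, cs < c → c < 0 → ∃ f : ℝ → ℝ, IsSolWithParam β a b c f ∧
        ∃ t₀ > 0, (∀ t ∈ Ioo 0 t₀, deriv (deriv f) t < 0) ∧
          (∀ t ∈ Ioi t₀, 0 < deriv (deriv f) t) ∧
          Tendsto (deriv f) atTop (𝓝 1)) ∧
      (∀ c : ℝ, 0 ≤ c → c ≤ cstar → ∃ f : ℝ → ℝ, IsSolWithParam β a b c f ∧
        (∀ t ∈ Ici (0 : ℝ), 0 ≤ deriv (deriv f) t ∧ b ≤ deriv f t ∧ deriv f t ≤ 1) ∧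
        Tendsto (deriv f) atTop (𝓝 1)) ∧
      (∀ c : ℝ, cstar < c → ∃ f : ℝ → ℝ, IsSolWithParam β a b c f ∧
        ∃ t₀ > 0, (∀ t ∈ Ico 0 t₀, 0 < deriv (deriv f) t) ∧
          (∀ t ∈ Ioi t₀, deriv (deriv f) t < 0) ∧
          Tendsto (deriv f) atTop (𝓝 1)) := by
  have hP : FS.Par β a b := ⟨hβ1, hβ2, ha, hb1, hb2⟩
  obtain ⟨cs, hcs, hlow, hup, f, hf, hfp, hr⟩ := FS.part_low hP
  have hne : (FS.X β a b).Nonempty := ⟨_, FS.X_ne hP⟩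
  have hbdd : BddBelow (FS.X β a b) := ⟨0, fun c hc => hc.1⟩
  refine ⟨cs, sInf (FS.X β a b), hcs, le_csInf hne (fun c hc => (FS.X_gt hP hc).le),
    fun c hc => FS.bad_no_sol hP (hlow c hc), ⟨f, hf, hr, FS.typeC_lim hP hf hfp hr⟩,
    fun c h1 h2 => FS.part_iii hP hup h1 h2, fun c h1 h2 => FS.part_iv hP h1 ?_,
    fun c h => FS.part_v hP ?_⟩
  · intro hX
    obtain ⟨c', hc', hlt⟩ := FS.X_open hP hX
    linarith [csInf_le hbdd hc']
  · obtain ⟨c', hc', hlt⟩ := exists_lt_of_csInf_lt hne h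
    exact FS.X_up hP hc' hlt
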